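/- arXiv:1703.05559 — 3 statements merged into one kernel-verified Lean document; each statement's English description precedes it below -/
import Mathlib

section
/- There is a sequence (ε_k)_{k≥1} of nonnegative reals with lim_{k→∞} ε_k = 0 such that for every k ≥ 2, every valid connection k-pattern M, and every subset A ⊆ P_k = {{i, i+1} : i ∈ [k−1]}, the pathwidth of the graph ([k], I_M ∪ A) is at most |A|/3 + ε_k·k. -/
/-- A perfect matching on the vertex set `V`, given by its edge set. -/
def IsPerfectMatchingEdgeSet {V : Type*} (M : Set (Sym2 V)) : Prop :=
  (∀ e ∈ M, ¬ e.IsDiag) ∧ ∀ v : V, ∃! e, e ∈ M ∧ v ∈ e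

/-- The identification pairs for validity: (1-indexed) `2i ~ (2i+1) mod 2k`,
i.e. (0-indexed) `2j+1 ~ 2j+2 (mod 2k)` for `j = 0, …, k-1`. -/
def nuEdges (k : ℕ) : Set (Sym2 (Fin (2 * k))) :=
  { e | ∃ j : Fin k,
      e = s((⟨(2 * j.val + 1) % (2 * k), Nat.mod_lt _ (by have := j.isLt; omega)⟩ : Fin (2 * k)),
            (⟨(2 * j.val + 2) % (2 * k), Nat.mod_lt _ (by have := j.isLt; omega)⟩ : Fin (2 * k))) }

/-- A valid connection `k`-pattern: a perfect matching whose identification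
(equivalently: union with the identification pairs is connected) is a single
`k`-cycle. -/
def IsValidPattern (k : ℕ) (M : Set (Sym2 (Fin (2 * k)))) : Prop :=
  IsPerfectMatchingEdgeSet M ∧ (SimpleGraph.fromEdgeSet (M ∪ nuEdges k)).Connected

/-- `I_M`: the edge set on `[k]` obtained from `M` by identifying `2i-1` and `2i`
into the vertex `i` (0-indexed: `v ↦ ⌊v/2⌋`), discarding loops. -/
def IM (k : ℕ) (M : Set (Sym2 (Fin (2 * k)))) : Set (Sym2 (Fin k)) :=
  { e | ¬ e.IsDiag ∧ ∃ e' ∈ M,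
      Sym2.map (fun v : Fin (2 * k) => (⟨v.val / 2, by have := v.isLt; omega⟩ : Fin k)) e' = e }

/-- `P_k = {{i, i+1} : i ∈ [k-1]}`, the set of consecutive pairs in `[k]`. -/
def Pk (k : ℕ) : Set (Sym2 (Fin k)) :=
  { e | ∃ (i : ℕ) (h : i + 1 < k), e = s((⟨i, by omega⟩ : Fin k), (⟨i + 1, h⟩ : Fin k)) }

/-- `G` has pathwidth at most `w` (here `w : ℝ`). -/
def PathwidthAtMost {V : Type*} (G : SimpleGraph V) (w : ℝ) : Prop :=
  ∃ (r : ℕ) (X : Fin r → Finset V),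
    (∀ v, ∃ t, v ∈ X t) ∧
    (∀ e ∈ G.edgeSet, ∃ t, ∀ v ∈ e, v ∈ X t) ∧
    (∀ (v : V) (t₁ t₂ t₃ : Fin r), t₁ ≤ t₂ → t₂ ≤ t₃ → v ∈ X t₁ → v ∈ X t₃ → v ∈ X t₂) ∧
    (∀ t, ((X t).card : ℝ) ≤ w + 1)

/-- The total multiplicity, with respect to `w`, of the pairs from `X` to `Y`. -/
def edgeWeight {V : Type*} (w : V → V → ℤ) (X Y : Finset V) : ℤ :=
  ∑ x ∈ X, ∑ y ∈ Y, w x y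

/-- `w` is the multiplicity function of a loopless multigraph all of whose degrees are 2 or 3. -/
structure IsTwoThreeMultigraph {V : Type*} [Fintype V] (w : V → V → ℤ) : Prop where
  symm : ∀ u v, w u v = w v u
  nonneg : ∀ u v, 0 ≤ w u v
  irrefl : ∀ v, w v v = 0
  degree : ∀ v, ∑ u, w v u = 2 ∨ ∑ u, w v u = 3

section EdgeWeight

variable {V : Type*} {w : V → V → ℤ}

theorem edgeWeight_comm (hs : ∀ u v, w u v = w v u) (X Y : Finset V) :
    edgeWeight w X Y = edgeWeight w Y X := by
  unfold edgeWeight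
  rw [Finset.sum_comm]
  simp only [hs]

theorem edgeWeight_nonneg (hn : ∀ u v, 0 ≤ w u v) (X Y : Finset V) : 0 ≤ edgeWeight w X Y :=
  Finset.sum_nonneg fun _ _ => Finset.sum_nonneg fun _ _ => hn _ _

theorem edgeWeight_union_left [DecidableEq V] {X X' : Finset V} (h : Disjoint X X') (Y : Finset V) :
    edgeWeight w (X ∪ X') Y = edgeWeight w X Y + edgeWeight w X' Y :=
  Finset.sum_union h

theorem edgeWeight_union_right [DecidableEq V] (X : Finset V) {Y Y' : Finset V}
    (h : Disjoint Y Y') : edgeWeight w X (Y ∪ Y') = edgeWeight w X Y + edgeWeight w X Y' := by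
  simp only [edgeWeight, Finset.sum_union h, Finset.sum_add_distrib]

theorem edgeWeight_mono (hn : ∀ u v, 0 ≤ w u v) {X X' Y Y' : Finset V} (hX : X ⊆ X')
    (hY : Y ⊆ Y') : edgeWeight w X Y ≤ edgeWeight w X' Y' :=
  (Finset.sum_le_sum fun _ _ =>
    Finset.sum_le_sum_of_subset_of_nonneg hY fun _ _ _ => hn _ _).trans
    (Finset.sum_le_sum_of_subset_of_nonneg hX fun _ _ _ => Finset.sum_nonneg fun _ _ => hn _ _)

theorem edgeWeight_biUnion_right [DecidableEq V] {ι : Type*} (X : Finset V) (s : Finset ι)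
    (F : ι → Finset V) (h : Set.PairwiseDisjoint (s : Set ι) F) :
    edgeWeight w X (s.biUnion F) = ∑ i ∈ s, edgeWeight w X (F i) := by
  simp only [edgeWeight, Finset.sum_biUnion h]
  rw [Finset.sum_comm]

theorem exists_pos_of_edgeWeight_ne_zero {X Y : Finset V} (hn : ∀ u v, 0 ≤ w u v)
    (h : edgeWeight w X Y ≠ 0) : ∃ x ∈ X, ∃ y ∈ Y, 0 < w x y := by
  obtain ⟨x, hx, h1⟩ := Finset.exists_ne_zero_of_sum_ne_zero h
  obtain ⟨y, hy, h2⟩ := Finset.exists_ne_zero_of_sum_ne_zero h1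
  exact ⟨x, hx, y, hy, lt_of_le_of_ne (hn _ _) h2.symm⟩

theorem le_edgeWeight (hn : ∀ u v, 0 ≤ w u v) {X Y : Finset V} {x y : V} (hx : x ∈ X)
    (hy : y ∈ Y) : w x y ≤ edgeWeight w X Y := by
  have := edgeWeight_mono hn (Finset.singleton_subset_iff.2 hx) (Finset.singleton_subset_iff.2 hy)
  simpa [edgeWeight] using this

theorem edgeWeight_compl_comm [Fintype V] [DecidableEq V] (hs : ∀ u v, w u v = w v u)
    (X : Finset V) : edgeWeight w Xᶜ Xᶜᶜ = edgeWeight w X Xᶜ := by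
  rw [compl_compl, edgeWeight_comm hs]

theorem edgeWeight_sdiff_compl [Fintype V] [DecidableEq V] (hs : ∀ u v, w u v = w v u)
    {R H : Finset V} (hH : H ⊆ R) :
    edgeWeight w (R \ H) (R \ H)ᶜ =
      edgeWeight w R Rᶜ - edgeWeight w H Rᶜ + edgeWeight w H (R \ H) := by
  have h1 : (R \ H)ᶜ = Rᶜ ∪ H := by ext; simp; tauto
  have h2 : Disjoint Rᶜ H := by
    rw [Finset.disjoint_left]; intro x hx hx'; exact (Finset.mem_compl.1 hx) (hH hx')
  have h3 := edgeWeight_union_left (w := w) (Finset.sdiff_disjoint : Disjoint (R \ H) H) Rᶜ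
  rw [Finset.sdiff_union_of_subset hH] at h3
  rw [h1, edgeWeight_union_right _ h2, edgeWeight_comm hs (R \ H) H]
  linarith

end EdgeWeight

section ConnectedParts

variable {V : Type*} [Fintype V] {w : V → V → ℤ}

theorem edgeWeight_univ_le (hw : IsTwoThreeMultigraph w) (X : Finset V) :
    edgeWeight w X Finset.univ ≤ 3 * X.card := by
  unfold edgeWeight
  calc _ ≤ ∑ x ∈ X, (3 : ℤ) :=
        Finset.sum_le_sum fun x _ => by rcases hw.degree x with h | h <;> omega
    _ = _ := by simp [mul_comm]

/-- A set that is minimally partitioned into connected parts of size at most `2 * L`: two distinct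
parts of size at most `L` are not adjacent. -/
theorem exists_minimal_partition [DecidableEq V] (hw : IsTwoThreeMultigraph w) (T : Finset V)
    {L : ℕ} (hL : 1 ≤ L) :
    ∃ c : V → V,
      (∀ r, (T.filter (c · = r)).card ≤ 2 * L) ∧
      (∀ r, (T.filter (c · = r)).Nonempty →
        2 * ((T.filter (c · = r)).card : ℤ) - 2 ≤
          edgeWeight w (T.filter (c · = r)) (T.filter (c · = r))) ∧
      ∀ r s, r ≠ s → (T.filter (c · = r)).card ≤ L → (T.filter (c · = s)).card ≤ L →
        edgeWeight w (T.filter (c · = r)) (T.filter (c · = s)) = 0 := by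
  classical
  let Good : (V → V) → Prop := fun c =>
    (∀ r, (T.filter (c · = r)).card ≤ 2 * L) ∧
      (∀ r, (T.filter (c · = r)).Nonempty →
        2 * ((T.filter (c · = r)).card : ℤ) - 2 ≤
          edgeWeight w (T.filter (c · = r)) (T.filter (c · = r)))
  have hid : Good id := by
    have hc : ∀ r, (T.filter (id · = r)).card ≤ 1 := fun r =>
      Finset.card_le_one.2 (by simp +contextual)
    refine ⟨fun r => (hc r).trans (by omega), fun r _ => ?_⟩
    have := edgeWeight_nonneg hw.nonneg (T.filter (id · = r)) (T.filter (id · = r))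
    have := hc r
    omega
  obtain ⟨c, hc, hmin⟩ := Set.exists_min_image {c | Good c} (fun c => (T.image c).card)
    (Set.toFinite _) ⟨id, hid⟩
  refine ⟨c, hc.1, hc.2, fun r s hrs hr hs => ?_⟩
  by_contra hne
  obtain ⟨x, hx, y, hy, hxy⟩ := exists_pos_of_edgeWeight_ne_zero hw.nonneg hne
  let c' : V → V := fun v => if c v = r then s else c v
  have hfs : T.filter (c' · = s) = T.filter (c · = r) ∪ T.filter (c · = s) := by
    ext v; simp only [c', Finset.mem_filter, Finset.mem_union]; split_ifs with h <;> grind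
  have hfr : T.filter (c' · = r) = ∅ := by
    ext v; simp only [c', Finset.mem_filter]; split_ifs with h <;> simp [h, hrs.symm]
  have hft : ∀ t, t ≠ r → t ≠ s → T.filter (c' · = t) = T.filter (c · = t) := by
    intro t h1 h2
    ext v; simp only [c', Finset.mem_filter]; split_ifs with h
    · simp [h, h1.symm, h2.symm]
    · rfl
  have hdis : Disjoint (T.filter (c · = r)) (T.filter (c · = s)) := by
    rw [Finset.disjoint_left]; intro v; simp only [Finset.mem_filter]; grind
  have hgood : Good c' := by
    constructor
    · intro t
      by_cases h2 : t = s
      · subst h2; rw [hfs, Finset.card_union_of_disjoint hdis]; omega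
      by_cases h1 : t = r
      · subst h1; rw [hfr]; simp
      rw [hft t h1 h2]; exact hc.1 t
    · intro t ht
      by_cases h2 : t = s
      · subst h2
        rw [hfs, Finset.card_union_of_disjoint hdis, edgeWeight_union_left hdis,
          edgeWeight_union_right _ hdis, edgeWeight_union_right _ hdis,
          edgeWeight_comm hw.symm (T.filter (c · = t)) (T.filter (c · = r))]
        have := hc.2 r ⟨x, hx⟩
        have := hc.2 t ⟨y, hy⟩
        have := le_edgeWeight hw.nonneg hx hy
        push_cast
        linarith
      by_cases h1 : t = r
      · subst h1; rw [hfr] at ht; simp at ht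
      rw [hft t h1 h2] at ht ⊢; exact hc.2 t ht
  have hsub : T.image c' ⊆ (T.image c).erase r := by
    intro t ht
    obtain ⟨v, hv, rfl⟩ := Finset.mem_image.1 ht
    simp only [Finset.mem_filter] at hx hy
    simp only [c', Finset.mem_erase, Finset.mem_image]
    split_ifs with h
    · exact ⟨hrs.symm, y, hy⟩
    · exact ⟨h, v, hv, rfl⟩
  have h1 := Finset.card_le_card hsub
  have h2 := hmin c' hgood
  simp only [Finset.mem_filter] at hx
  have h3 : r ∈ T.image c := Finset.mem_image.2 ⟨x, hx⟩
  have h4 := Finset.card_erase_lt_of_mem h3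
  omega

/-- Every set can be partitioned into connected parts of bounded size, each of which is either
large or a union of connected components. -/
theorem exists_connected_partition [DecidableEq V] (hw : IsTwoThreeMultigraph w) (T : Finset V)
    {L : ℕ} (hL : 1 ≤ L) :
    ∃ c : V → V,
      (∀ r, (T.filter (c · = r)).card ≤ 2 * L + 6 * L * L) ∧
      (∀ r, (T.filter (c · = r)).Nonempty →
        2 * ((T.filter (c · = r)).card : ℤ) - 2 ≤
          edgeWeight w (T.filter (c · = r)) (T.filter (c · = r))) ∧
      ∀ r, L < (T.filter (c · = r)).card ∨
        edgeWeight w (T.filter (c · = r)) (T \ T.filter (c · = r)) = 0 := by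
  classical
  obtain ⟨c, hc1, hc2, hc3⟩ := exists_minimal_partition hw T hL
  set F : V → Finset V := fun r => T.filter (c · = r) with hF
  have hFd : ∀ r s, r ≠ s → Disjoint (F r) (F s) := by
    intro r s hrs
    rw [Finset.disjoint_left]; intro v; simp only [hF, Finset.mem_filter]; grind
  let Q : V → V → Prop := fun r s => (F r).card ≤ L ∧ L < (F s).card ∧ edgeWeight w (F r) (F s) ≠ 0
  let φ : V → V := fun r => if h : ∃ s, Q r s then h.choose else r
  have hφQ : ∀ r, Q r (φ r) ∨ (φ r = r ∧ ¬ ∃ s, Q r s) := by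
    intro r
    by_cases h : ∃ s, Q r s
    · left; simp only [φ, dif_pos h]; exact h.choose_spec
    · right; exact ⟨by simp only [φ, dif_neg h], h⟩
  have hφL : ∀ s, L < (F s).card → φ s = s := by
    intro s hs
    rcases hφQ s with h | h
    · exact absurd h.1 (by omega)
    · exact h.1
  -- a new part that is small is an old part without outside neighbours
  have hsmall : ∀ s, (F s).card ≤ L → T.filter (fun v => φ (c v) = s) = ∅ ∨
      (T.filter (fun v => φ (c v) = s) = F s ∧ ¬ ∃ t, Q s t) := by
    intro s hs
    have key : ∀ r, φ r = s → r = s := by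
      intro r hr
      rcases hφQ r with h | h
      · rw [hr] at h; exact absurd h.2.1 (by omega)
      · rw [← hr, h.1]
    by_cases hs' : φ s = s
    · right
      refine ⟨?_, ?_⟩
      · ext v; simp only [hF, Finset.mem_filter]
        constructor
        · rintro ⟨h1, h2⟩; exact ⟨h1, key _ h2⟩
        · rintro ⟨h1, h2⟩; exact ⟨h1, by rw [h2, hs']⟩
      · rcases hφQ s with h | h
        · rw [hs'] at h; exact absurd h.2.1 (by omega)
        · exact h.2
    · left
      ext v; simp only [Finset.mem_filter]
      constructor
      · rintro ⟨_, h2⟩; exact absurd (by rwa [key _ h2] at h2) hs'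
      · simp
  have hlarge : ∀ s, L < (F s).card → ∃ J : Finset V, s ∉ J ∧ (∀ r ∈ J, Q r s) ∧
      T.filter (fun v => φ (c v) = s) = F s ∪ J.biUnion F := by
    intro s hs
    refine ⟨Finset.univ.filter (fun r => r ≠ s ∧ φ r = s), by simp, ?_, ?_⟩
    · intro r hr
      simp only [Finset.mem_filter, Finset.mem_univ, true_and] at hr
      rcases hφQ r with h | h
      · rw [hr.2] at h; exact h
      · exact absurd (h.1.symm.trans hr.2) hr.1
    · ext v
      simp only [hF, Finset.mem_filter, Finset.mem_union, Finset.mem_biUnion,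
        Finset.mem_univ, true_and]
      constructor
      · rintro ⟨h1, h2⟩
        by_cases h3 : c v = s
        · exact Or.inl ⟨h1, h3⟩
        · exact Or.inr ⟨c v, ⟨h3, h2⟩, h1, rfl⟩
      · rintro (⟨h1, h2⟩ | ⟨r, ⟨_, h3⟩, h4, h5⟩)
        · exact ⟨h1, by rw [h2, hφL s hs]⟩
        · exact ⟨h4, by rw [h5, h3]⟩
  have hJ : ∀ s (J : Finset V), s ∉ J → (∀ r ∈ J, Q r s) → Disjoint (F s) (J.biUnion F) ∧
      Set.PairwiseDisjoint (J : Set V) F := by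
    intro s J hsJ _
    refine ⟨?_, fun r _ t _ hrt => hFd r t hrt⟩
    rw [Finset.disjoint_biUnion_right]
    intro r hr
    exact hFd s r (by rintro rfl; exact hsJ hr)
  have hQpos : ∀ r s, Q r s → 1 ≤ edgeWeight w (F s) (F r) := by
    intro r s h
    have h1 := edgeWeight_nonneg hw.nonneg (F r) (F s)
    have h2 := h.2.2
    rw [edgeWeight_comm hw.symm (F s)]
    omega
  refine ⟨fun v => φ (c v), fun s => ?_, fun s hne => ?_, fun s => ?_⟩
  · rcases le_or_gt (F s).card L with hs | hs
    · rcases hsmall s hs with h | h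
      · rw [h]; simp
      · rw [h.1]; nlinarith [hc1 s]
    · obtain ⟨J, hsJ, hJQ, hJe⟩ := hlarge s hs
      obtain ⟨hd1, hd2⟩ := hJ s J hsJ hJQ
      rw [hJe, Finset.card_union_of_disjoint hd1, Finset.card_biUnion hd2]
      have h1 : (J.card : ℤ) ≤ 6 * L := by
        calc (J.card : ℤ) = ∑ r ∈ J, 1 := by simp
          _ ≤ ∑ r ∈ J, edgeWeight w (F s) (F r) :=
            Finset.sum_le_sum fun r hr => hQpos r s (hJQ r hr)
          _ = edgeWeight w (F s) (J.biUnion F) := (edgeWeight_biUnion_right _ _ _ hd2).symm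
          _ ≤ edgeWeight w (F s) Finset.univ :=
            edgeWeight_mono hw.nonneg subset_rfl (Finset.subset_univ _)
          _ ≤ 3 * (F s).card := edgeWeight_univ_le hw _
          _ ≤ 6 * L := by have := hc1 s; simp only [hF]; omega
      have h2 : ∑ r ∈ J, (F r).card ≤ J.card * L := by
        rw [← smul_eq_mul]
        exact Finset.sum_le_card_nsmul _ _ _ fun r hr => (hJQ r hr).1
      have h3 : J.card ≤ 6 * L := by exact_mod_cast h1
      have := hc1 s
      calc _ ≤ 2 * L + J.card * L := add_le_add this h2
        _ ≤ _ := by gcongr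
  · rcases le_or_gt (F s).card L with hs | hs
    · rcases hsmall s hs with h | h
      · rw [h] at hne; simp at hne
      · rw [h.1] at hne ⊢; exact hc2 s hne
    · obtain ⟨J, hsJ, hJQ, hJe⟩ := hlarge s hs
      obtain ⟨hd1, hd2⟩ := hJ s J hsJ hJQ
      rw [hJe, Finset.card_union_of_disjoint hd1, Finset.card_biUnion hd2,
        edgeWeight_union_left hd1, edgeWeight_union_right _ hd1, edgeWeight_union_right _ hd1,
        edgeWeight_comm hw.symm (J.biUnion F) (F s), edgeWeight_biUnion_right _ _ _ hd2]
      have h1 : ∑ r ∈ J, edgeWeight w (F r) (F r) ≤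
          edgeWeight w (J.biUnion F) (J.biUnion F) := by
        conv_rhs => rw [edgeWeight, Finset.sum_biUnion hd2]
        exact Finset.sum_le_sum fun r hr => edgeWeight_mono hw.nonneg subset_rfl
          (Finset.subset_biUnion_of_mem F hr)
      have h2 := hc2 s (Finset.card_pos.1 (by simp only [hF] at hs; omega))
      have h3 : ∑ r ∈ J, (2 * ((F r).card : ℤ)) ≤
          ∑ r ∈ J, (edgeWeight w (F r) (F r) + 2 * edgeWeight w (F s) (F r)) := by
        refine Finset.sum_le_sum fun r hr => ?_
        have h4 := hQpos r s (hJQ r hr)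
        have h5 := hc2 r (by
          rw [Finset.nonempty_iff_ne_empty]
          intro h0
          have := (hJQ r hr).2.2
          simp only [hF] at this
          rw [h0] at this
          simp [edgeWeight] at this)
        simp only [hF] at h4 ⊢
        linarith
      rw [Finset.sum_add_distrib, ← Finset.mul_sum, ← Finset.mul_sum] at h3
      push_cast
      simp only [hF] at *
      linarith
  · rcases le_or_gt (F s).card L with hs | hs
    · right
      rcases hsmall s hs with h | h
      · rw [h]; simp [edgeWeight]
      · rw [h.1]
        by_contra hne
        obtain ⟨x, hx, y, hy, hxy⟩ := exists_pos_of_edgeWeight_ne_zero hw.nonneg hne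
        have hyF : y ∈ F (c y) := by simp only [hF, Finset.mem_filter, and_true]; grind
        have hcy : s ≠ c y := by
          rintro rfl; exact (Finset.mem_sdiff.1 hy).2 hyF
        have hpos : edgeWeight w (F s) (F (c y)) ≠ 0 :=
          (lt_of_lt_of_le hxy (le_edgeWeight hw.nonneg hx hyF)).ne'
        rcases le_or_gt (F (c y)).card L with hy' | hy'
        · exact hpos (hc3 s (c y) hcy hs hy')
        · exact h.2 ⟨c y, hs, hy', hpos⟩
    · left
      obtain ⟨J, hsJ, hJQ, hJe⟩ := hlarge s hs
      rw [hJe]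
      exact lt_of_lt_of_le hs (Finset.card_le_card Finset.subset_union_left)

end ConnectedParts

section LocalImprovement

variable {V : Type*} [Fintype V] {w : V → V → ℤ}

/-- The sum of `degree - 2` over the vertices in `X`. -/
def degreeExcess (w : V → V → ℤ) (X : Finset V) : ℤ :=
  ∑ v ∈ X, (∑ u, w v u - 2)

theorem degreeExcess_mono (hw : IsTwoThreeMultigraph w) {X Y : Finset V} (h : X ⊆ Y) :
    degreeExcess w X ≤ degreeExcess w Y :=
  Finset.sum_le_sum_of_subset_of_nonneg h fun v _ _ => by
    rcases hw.degree v with h | h <;> omega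

theorem degreeExcess_nonneg (hw : IsTwoThreeMultigraph w) (H : Finset V) :
    0 ≤ degreeExcess w H :=
  Finset.sum_nonneg fun v _ => by rcases hw.degree v with h | h <;> omega

theorem degreeExcess_le_card (hw : IsTwoThreeMultigraph w) (H : Finset V) :
    degreeExcess w H ≤ H.card := by
  calc degreeExcess w H ≤ ∑ v ∈ H, (1 : ℤ) :=
        Finset.sum_le_sum fun v _ => by rcases hw.degree v with h | h <;> omega
    _ = _ := by simp

/-- An upper bound for the size of the improving sets in `edgeWeight_compl_le_of_no_gain`. -/
def gainBound (L : ℕ) : ℕ :=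
  (2 * L + 6 * L * L) +
    3 * (2 * L + 6 * L * L) * (1 + 3 * (4 * (2 * L + 6 * L * L)))

theorem one_le_gainBound {L : ℕ} (hL : 1 ≤ L) : 1 ≤ gainBound L := by
  unfold gainBound
  omega

theorem card_filter_adj_le (hw : IsTwoThreeMultigraph w) (X Y : Finset V) :
    (Y.filter (fun y => ∃ x ∈ X, 0 < w x y)).card ≤ 3 * X.card := by
  classical
  have h1 : ((Y.filter (fun y => ∃ x ∈ X, 0 < w x y)).card : ℤ) ≤ 3 * X.card := by
    calc _ = ∑ y ∈ Y.filter (fun y => ∃ x ∈ X, 0 < w x y), (1 : ℤ) := by simp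
      _ ≤ ∑ y ∈ Y.filter (fun y => ∃ x ∈ X, 0 < w x y), ∑ x ∈ X, w y x := by
        refine Finset.sum_le_sum fun y hy => ?_
        obtain ⟨x, hx, hxy⟩ := (Finset.mem_filter.1 hy).2
        rw [hw.symm] at hxy
        exact (Int.add_one_le_iff.2 hxy).trans
          (Finset.single_le_sum (f := fun x => w y x) (fun x _ => hw.nonneg y x) hx)
      _ = edgeWeight w (Y.filter (fun y => ∃ x ∈ X, 0 < w x y)) X := rfl
      _ = edgeWeight w X (Y.filter (fun y => ∃ x ∈ X, 0 < w x y)) := edgeWeight_comm hw.symm _ _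
      _ ≤ edgeWeight w X Finset.univ :=
        edgeWeight_mono hw.nonneg subset_rfl (Finset.subset_univ _)
      _ ≤ _ := edgeWeight_univ_le hw X
  exact_mod_cast h1

/-- If no vertex and no small set can be moved out of `R` with a gain, then the cut between `R` and
its complement is at most about a third of the number of vertices of degree 3 in `R`. -/
theorem edgeWeight_compl_le_of_no_gain [DecidableEq V] (hw : IsTwoThreeMultigraph w) {L : ℕ}
    (hL : 1 ≤ L) (R : Finset V) (hR : ∀ v ∈ R, ∑ u ∈ Rᶜ, w v u < ∑ u ∈ R, w v u)
    (hno : ∀ H ⊆ R, H.card ≤ gainBound L → edgeWeight w H Rᶜ ≤ edgeWeight w H (R \ H)) :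
    3 * (L * edgeWeight w R Rᶜ) ≤ L * degreeExcess w R + 2 * Fintype.card V := by
  classical
  set b : ℕ := 2 * L + 6 * L * L with hb
  have hdeg : ∀ v, ∑ u ∈ R, w v u + ∑ u ∈ Rᶜ, w v u = ∑ u, w v u := fun v =>
    Finset.sum_add_sum_compl R _
  have hnn : ∀ v (X : Finset V), 0 ≤ ∑ u ∈ X, w v u := fun v X =>
    Finset.sum_nonneg fun u _ => hw.nonneg v u
  have hmono : ∀ v {X Y : Finset V}, X ⊆ Y → ∑ u ∈ X, w v u ≤ ∑ u ∈ Y, w v u := fun v X Y h =>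
    Finset.sum_le_sum_of_subset_of_nonneg h fun u _ _ => hw.nonneg v u
  have hpos : ∀ {v u} {X : Finset V}, u ∈ X → 0 < w v u → 1 ≤ ∑ u ∈ X, w v u :=
    fun {v u X} hu h => (Int.add_one_le_iff.2 h).trans
      (Finset.single_le_sum (f := fun x => w v x) (fun x _ => hw.nonneg v x) hu)
  set T₀ := R.filter (fun v => ∑ u ∈ Rᶜ, w v u = 0) with hT₀
  set T₁ := R.filter (fun v => ¬ ∑ u ∈ Rᶜ, w v u = 0) with hT₁
  have hTR : T₀ ∪ T₁ = R := Finset.filter_union_filter_not_eq _ _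
  have hTd : Disjoint T₀ T₁ := Finset.disjoint_filter_filter_not _ _ _
  have h0 : ∀ v ∈ R, v ∉ T₁ → ∑ u ∈ Rᶜ, w v u = 0 := by
    intro v hv h; by_contra h'; exact h (Finset.mem_filter.2 ⟨hv, h'⟩)
  have h1 : ∀ v ∈ T₁, ∑ u ∈ Rᶜ, w v u = 1 ∧ ∑ u ∈ R, w v u = 2 := by
    intro v hv
    obtain ⟨hvR, hv⟩ := Finset.mem_filter.1 hv
    have := hR v hvR
    have := hdeg v
    have := hnn v Rᶜ
    rcases hw.degree v with h | h <;> constructor <;> omega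
  have hT₀R : T₀ ⊆ R := Finset.filter_subset _ _
  have hT₁R : T₁ ⊆ R := Finset.filter_subset _ _
  have hgain : ∀ H ⊆ R, H.card ≤ gainBound L →
      ∑ t ∈ H.filter (· ∈ T₁), (∑ u ∈ H, w t u - 1) ≤
        ∑ v ∈ H.filter (· ∉ T₁), ∑ u ∈ R \ H, w v u := by
    intro H hH hc
    have h := hno H hH hc
    unfold edgeWeight at h
    rw [← Finset.sum_filter_add_sum_filter_not H (· ∈ T₁),
      ← Finset.sum_filter_add_sum_filter_not H (· ∈ T₁) (fun v => ∑ u ∈ R \ H, w v u)] at h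
    have e1 : ∑ v ∈ H.filter (· ∉ T₁), ∑ u ∈ Rᶜ, w v u = 0 :=
      Finset.sum_eq_zero fun v hv => h0 v (hH (Finset.mem_filter.1 hv).1) (Finset.mem_filter.1 hv).2
    have e2 : ∑ t ∈ H.filter (· ∈ T₁), (∑ u ∈ H, w t u - 1) =
        ∑ t ∈ H.filter (· ∈ T₁), ∑ u ∈ Rᶜ, w t u -
          ∑ t ∈ H.filter (· ∈ T₁), ∑ u ∈ R \ H, w t u := by
      rw [← Finset.sum_sub_distrib]
      refine Finset.sum_congr rfl fun t ht => ?_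
      have h2 := h1 t (Finset.mem_filter.1 ht).2
      have h3 := Finset.sum_sdiff (f := fun u => w t u) hH
      omega
    rw [e2]
    linarith
  obtain ⟨c, hc1, hc2, hc3⟩ := exists_connected_partition hw T₀ hL
  set F : V → Finset V := fun r => T₀.filter (c · = r) with hF
  have hFT : ∀ r, F r ⊆ T₀ := fun r => Finset.filter_subset _ _
  have hFd : ∀ r s, r ≠ s → Disjoint (F r) (F s) := by
    intro r s hrs
    rw [Finset.disjoint_left]; intro v; simp only [hF, Finset.mem_filter]; grind
  set U := T₁ ∪ T₀.filter (fun y => (F (c y)).card ≤ L) with hU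
  have hUR : U ⊆ R := Finset.union_subset hT₁R ((Finset.filter_subset _ _).trans hT₀R)
  let Z : V → Finset V := fun y => if y ∈ T₁ then {y} else
    F (c y) ∪ T₁.filter (fun t => ∃ x ∈ F (c y), 0 < w x t)
  have hZR : ∀ y ∈ U, Z y ⊆ R := by
    intro y hy
    simp only [Z]
    split_ifs with h
    · simpa using hT₁R h
    · exact Finset.union_subset ((hFT _).trans hT₀R) ((Finset.filter_subset _ _).trans hT₁R)
  have hZself : ∀ y ∈ U, y ∈ Z y := by
    intro y hy
    simp only [Z]
    split_ifs with h
    · simp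
    · simp only [hU, Finset.mem_union, Finset.mem_filter] at hy
      simp only [hF, Finset.mem_union, Finset.mem_filter]
      tauto
  have hZcard : ∀ y ∈ U, (Z y).card ≤ 4 * b := by
    intro y hy
    simp only [Z]
    split_ifs with h
    · have : 1 ≤ b := by nlinarith
      simp; omega
    · have h2 := card_filter_adj_le hw (F (c y)) T₁
      have h3 := Finset.card_union_le (F (c y)) (T₁.filter (fun t => ∃ x ∈ F (c y), 0 < w x t))
      have h4 : (F (c y)).card ≤ b := hc1 (c y)
      omega
  have hZ₁ : ∀ y ∈ U, ∀ t ∈ Z y, t ∈ T₁ → t = y ∨ ∃ x ∈ Z y, 0 < w t x := by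
    intro y hy t ht htT
    simp only [Z] at ht ⊢
    split_ifs at ht ⊢ with h
    · left; simpa using ht
    · right
      rcases Finset.mem_union.1 ht with h2 | h2
      · exact absurd htT (Finset.disjoint_left.1 hTd (hFT _ h2))
      · obtain ⟨_, x, hx, hxt⟩ := Finset.mem_filter.1 h2
        exact ⟨x, Finset.mem_union_left _ hx, by rwa [hw.symm]⟩
  have hZ₀ : ∀ y ∈ U, ∀ v ∈ Z y, v ∉ T₁ → ∀ x ∈ R, 0 < w v x → x ∈ Z y := by
    intro y hy v hv hvT x hx hvx
    simp only [Z] at hv ⊢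
    split_ifs at hv ⊢ with h
    · rw [Finset.mem_singleton] at hv; rw [hv] at hvT; exact absurd h hvT
    · have hvF : v ∈ F (c y) := by
        rcases Finset.mem_union.1 hv with h2 | h2
        · exact h2
        · exact absurd (Finset.mem_filter.1 h2).1 hvT
      have hs : (F (c y)).card ≤ L := by
        simp only [hU, Finset.mem_union, Finset.mem_filter] at hy; tauto
      by_contra hxn
      rw [← hTR, Finset.mem_union] at hx
      rcases hx with hx | hx
      · have h5 : edgeWeight w (F (c y)) (T₀ \ F (c y)) = 0 :=
          (hc3 (c y)).resolve_left (not_lt.2 hs)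
        have h6 := le_edgeWeight hw.nonneg hvF (Finset.mem_sdiff.2 ⟨hx, fun h' =>
          hxn (Finset.mem_union_left _ h')⟩)
        omega
      · exact hxn (Finset.mem_union_right _ (Finset.mem_filter.2 ⟨hx, v, hvF, hvx⟩))
  let Y : V → Finset V := fun u => {u} ∪ (U.filter (0 < w u ·)).biUnion Z
  have hYR : ∀ u ∈ T₁, Y u ⊆ R := by
    intro u hu
    refine Finset.union_subset (by simpa using hT₁R hu) (Finset.biUnion_subset.2 fun y hy => ?_)
    exact hZR y (Finset.mem_filter.1 hy).1
  have hYcard : ∀ u, (Y u).card ≤ 1 + 3 * (4 * b) := by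
    intro u
    refine (Finset.card_union_le _ _).trans (add_le_add (by simp) ?_)
    refine (Finset.card_biUnion_le_card_mul _ _ (4 * b) fun y hy =>
      hZcard y (Finset.mem_filter.1 hy).1).trans ?_
    have := card_filter_adj_le hw {u} U
    simp only [Finset.mem_singleton, exists_eq_left, Finset.card_singleton] at this
    gcongr
  have main : ∀ P ⊆ T₀, ∀ N ⊆ T₁, P.card ≤ b → N.card ≤ 3 * b → Disjoint P U →
      (∀ u ∈ N, 1 ≤ ∑ x ∈ P, w u x + ∑ x ∈ U, w u x) →
      ∑ u ∈ N, (∑ x ∈ P, w u x + ∑ x ∈ U, w u x - 1) ≤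
        ∑ v ∈ P, ∑ x ∈ R \ (P ∪ N), w v x := by
    intro P hP N hN hPc hNc hPU hN1
    set H := P ∪ N.biUnion Y with hH
    have hYH : ∀ u ∈ N, Y u ⊆ H := fun u hu =>
      (Finset.subset_biUnion_of_mem Y hu).trans Finset.subset_union_right
    have hNH : N ⊆ H := fun u hu => hYH u hu (Finset.mem_union_left _ (by simp))
    have hHR : H ⊆ R := Finset.union_subset (hP.trans hT₀R)
      (Finset.biUnion_subset.2 fun u hu => hYR u (hN hu))
    have hHc : H.card ≤ gainBound L := by
      refine (Finset.card_union_le _ _).trans (add_le_add hPc ?_)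
      exact (Finset.card_biUnion_le_card_mul _ _ _ fun u _ => hYcard u).trans (by gcongr)
    have hZH : ∀ u ∈ N, ∀ y ∈ U, 0 < w u y → Z y ⊆ H := fun u hu y hy huy =>
      ((Finset.subset_biUnion_of_mem Z (Finset.mem_filter.2 ⟨hy, huy⟩)).trans
        Finset.subset_union_right).trans (hYH u hu)
    have hdg : ∀ u ∈ N, ∑ x ∈ P, w u x + ∑ x ∈ U, w u x ≤ ∑ x ∈ H, w u x := by
      intro u hu
      have e1 : ∑ x ∈ U, w u x = ∑ x ∈ U.filter (0 < w u ·), w u x := by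
        rw [Finset.sum_filter_of_ne]
        intro x _ hx
        exact lt_of_le_of_ne (hw.nonneg u x) hx.symm
      rw [e1, ← Finset.sum_union (hPU.mono_right (Finset.filter_subset _ _))]
      refine hmono u (Finset.union_subset Finset.subset_union_left fun y hy => ?_)
      obtain ⟨hy, huy⟩ := Finset.mem_filter.1 hy
      exact hZH u hu y hy huy (hZself y hy)
    have hT1H : ∀ t ∈ H, t ∈ T₁ → 1 ≤ ∑ x ∈ H, w t x := by
      intro t ht htT
      rcases Finset.mem_union.1 ht with h | h
      · exact absurd htT (Finset.disjoint_left.1 hTd (hP h))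
      obtain ⟨u, hu, htY⟩ := Finset.mem_biUnion.1 h
      rcases Finset.mem_union.1 htY with h | h
      · rw [Finset.mem_singleton.1 h]; exact (hN1 u hu).trans (hdg u hu)
      obtain ⟨y, hy, htZ⟩ := Finset.mem_biUnion.1 h
      obtain ⟨hy, huy⟩ := Finset.mem_filter.1 hy
      rcases hZ₁ y hy t htZ htT with h | ⟨x, hx, htx⟩
      · exact hpos (hNH hu) (by rwa [hw.symm, h])
      · exact hpos (hZH u hu y hy huy hx) htx
    have hT0H : ∀ v ∈ H, v ∉ T₁ → v ∉ P → ∑ x ∈ R \ H, w v x = 0 := by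
      intro v hv hvT hvP
      have h := (Finset.mem_union.1 hv).resolve_left hvP
      obtain ⟨u, hu, hvY⟩ := Finset.mem_biUnion.1 h
      rcases Finset.mem_union.1 hvY with h | h
      · rw [Finset.mem_singleton.1 h] at hvT; exact absurd (hN hu) hvT
      obtain ⟨y, hy, hvZ⟩ := Finset.mem_biUnion.1 h
      obtain ⟨hy, huy⟩ := Finset.mem_filter.1 hy
      refine Finset.sum_eq_zero fun x hx => ?_
      obtain ⟨hxR, hxH⟩ := Finset.mem_sdiff.1 hx
      by_contra hne
      exact hxH (hZH u hu y hy huy (hZ₀ y hy v hvZ hvT x hxR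
        (lt_of_le_of_ne (hw.nonneg v x) (Ne.symm hne))))
    calc ∑ u ∈ N, (∑ x ∈ P, w u x + ∑ x ∈ U, w u x - 1)
        ≤ ∑ u ∈ N, (∑ x ∈ H, w u x - 1) :=
          Finset.sum_le_sum fun u hu => sub_le_sub_right (hdg u hu) 1
      _ ≤ ∑ t ∈ H.filter (· ∈ T₁), (∑ u ∈ H, w t u - 1) :=
          Finset.sum_le_sum_of_subset_of_nonneg
            (fun u hu => Finset.mem_filter.2 ⟨hNH hu, hN hu⟩) fun t ht _ => by
              have := hT1H t (Finset.mem_filter.1 ht).1 (Finset.mem_filter.1 ht).2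
              omega
      _ ≤ ∑ v ∈ H.filter (· ∉ T₁), ∑ u ∈ R \ H, w v u := hgain H hHR hHc
      _ = ∑ v ∈ P, ∑ u ∈ R \ H, w v u := by
          symm
          refine Finset.sum_subset (fun v hv => Finset.mem_filter.2
            ⟨Finset.mem_union_left _ hv, Finset.disjoint_left.1 hTd (hP hv)⟩) fun v hv hvP => ?_
          exact hT0H v (Finset.mem_filter.1 hv).1 (Finset.mem_filter.1 hv).2 hvP
      _ ≤ _ := Finset.sum_le_sum fun v _ => hmono v (Finset.sdiff_subset_sdiff subset_rfl
          (Finset.union_subset Finset.subset_union_left hNH))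
  have hy1 : ∀ u ∈ T₁, ∑ x ∈ U, w u x ≤ 1 := by
    intro u hu
    by_contra hlt
    have h3 : (1 : ℕ) ≤ 3 * b := by nlinarith
    have := main ∅ (by simp) {u} (by simpa using hu) (by simp) (by simpa using h3) (by simp)
      (by simp; omega)
    simp at this
    omega
  set G := Finset.univ.filter (fun r => L < (F r).card) with hG
  have hGd : Set.PairwiseDisjoint (G : Set V) F := fun r _ s _ h => hFd r s h
  have hGU : R = U ∪ G.biUnion F := by
    ext v
    have : v ∈ R ↔ v ∈ T₀ ∨ v ∈ T₁ := by rw [← hTR, Finset.mem_union]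
    rw [this]
    simp only [hU, hG, hF, Finset.mem_union, Finset.mem_filter, Finset.mem_biUnion,
      Finset.mem_univ, true_and]
    constructor
    · rintro (h | h)
      · rcases le_or_gt (F (c v)).card L with h' | h'
        · exact Or.inl (Or.inr ⟨h, h'⟩)
        · exact Or.inr ⟨c v, h', h, rfl⟩
      · exact Or.inl (Or.inl h)
    · rintro ((h | h) | ⟨r, _, h, _⟩)
      · exact Or.inr h
      · exact Or.inl h.1
      · exact Or.inl h
  have hFU : ∀ r ∈ G, Disjoint (F r) U := by
    intro r hr
    rw [Finset.disjoint_left]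
    intro v hv hvU
    rcases Finset.mem_union.1 hvU with h | h
    · exact Finset.disjoint_left.1 hTd (hFT r hv) h
    · have h2 := (Finset.mem_filter.1 h).2
      rw [(Finset.mem_filter.1 hv).2] at h2
      exact absurd h2 (not_le.2 (Finset.mem_filter.1 hr).2)
  have hlarge : ∀ r ∈ G, ∑ u ∈ T₁, (1 + ∑ x ∈ U, w u x) * ∑ x ∈ F r, w u x ≤
      degreeExcess w (F r) + 2 := by
    intro r hr
    set N := T₁.filter (fun t => ∃ x ∈ F r, 0 < w x t) with hN
    have hPc : (F r).card ≤ b := hc1 r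
    have hN1 : ∀ u ∈ N, 1 ≤ ∑ x ∈ F r, w u x := by
      intro u hu
      obtain ⟨x, hx, hxu⟩ := (Finset.mem_filter.1 hu).2
      exact hpos hx (by rwa [hw.symm])
    have hm := main (F r) (hFT r) N (Finset.filter_subset _ _) hPc
      ((card_filter_adj_le hw _ _).trans (by omega)) (hFU r hr)
      (fun u hu => (hN1 u hu).trans (le_add_of_nonneg_right (hnn u U)))
    have h2 : ∑ v ∈ F r, ∑ x ∈ R \ (F r ∪ N), w v x ≤ edgeWeight w (F r) (T₀ \ F r) := by
      refine Finset.sum_le_sum fun v hv => ?_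
      rw [← Finset.sum_filter_of_ne (p := fun x => 0 < w v x)
        (fun x _ hx => lt_of_le_of_ne (hw.nonneg v x) hx.symm)]
      refine hmono v fun x hx => ?_
      obtain ⟨hx, hvx⟩ := Finset.mem_filter.1 hx
      obtain ⟨hxR, hx⟩ := Finset.mem_sdiff.1 hx
      rw [← hTR, Finset.mem_union] at hxR
      refine Finset.mem_sdiff.2 ⟨hxR.resolve_right fun h => hx ?_, fun h => hx ?_⟩
      · exact Finset.mem_union_right _ (Finset.mem_filter.2 ⟨h, v, hv, hvx⟩)
      · exact Finset.mem_union_left _ h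
    have h3 : edgeWeight w (F r) R = degreeExcess w (F r) + 2 * (F r).card := by
      unfold edgeWeight degreeExcess
      rw [Finset.sum_sub_distrib, Finset.sum_const, nsmul_eq_mul, mul_comm 2, sub_add_cancel]
      refine Finset.sum_congr rfl fun v hv => ?_
      rw [← hdeg v, h0 v (hT₀R (hFT r hv)) (Finset.disjoint_left.1 hTd (hFT r hv)), add_zero]
    have h4 : edgeWeight w (F r) R = edgeWeight w (F r) (F r) + edgeWeight w (F r) (T₀ \ F r) +
        ∑ u ∈ T₁, ∑ x ∈ F r, w u x := by
      conv_lhs => rw [← hTR, edgeWeight_union_right _ hTd,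
        ← Finset.union_sdiff_of_subset (hFT r), edgeWeight_union_right _ Finset.disjoint_sdiff,
        edgeWeight_comm hw.symm (F r) T₁]
      rfl
    have h5 := hc2 r (Finset.card_pos.1 (lt_of_le_of_lt (Nat.zero_le _) (Finset.mem_filter.1 hr).2))
    have h6 : ∑ u ∈ N, (∑ x ∈ F r, w u x + ∑ x ∈ U, w u x - 1) =
        ∑ u ∈ T₁, if (∃ x ∈ F r, 0 < w x u) then
          (∑ x ∈ F r, w u x + ∑ x ∈ U, w u x - 1) else 0 := by
      rw [hN, Finset.sum_filter]
    have h7 : ∑ u ∈ T₁, (1 + ∑ x ∈ U, w u x) * ∑ x ∈ F r, w u x ≤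
        ∑ u ∈ N, (∑ x ∈ F r, w u x + ∑ x ∈ U, w u x - 1) + ∑ u ∈ T₁, ∑ x ∈ F r, w u x := by
      rw [h6, ← Finset.sum_add_distrib]
      refine Finset.sum_le_sum fun u hu => ?_
      have h8 := hy1 u hu
      have h9 := hnn u U
      split_ifs with h
      · have := hN1 u (Finset.mem_filter.2 ⟨hu, h⟩)
        nlinarith
      · have : ∑ x ∈ F r, w u x = 0 := by
          refine Finset.sum_eq_zero fun x hx => ?_
          by_contra hne
          exact h ⟨x, hx, lt_of_le_of_ne (hw.nonneg x u) (by rw [hw.symm]; exact Ne.symm hne)⟩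
        rw [this]; simp
    simp only [hF] at *
    linarith
  have hsum := Finset.sum_le_sum hlarge
  rw [Finset.sum_comm, Finset.sum_add_distrib] at hsum
  have hG1 : ∀ u ∈ T₁, 2 ≤ ∑ r ∈ G, (1 + ∑ x ∈ U, w u x) * ∑ x ∈ F r, w u x := by
    intro u hu
    rw [← Finset.mul_sum, ← Finset.sum_biUnion hGd]
    have h2 := (h1 u hu).2
    rw [hGU, Finset.sum_union ((Finset.disjoint_biUnion_right _ _ _).2
      fun r hr => (hFU r hr).symm)] at h2
    have h3 : ∑ x ∈ G.biUnion F, w u x = 2 - ∑ x ∈ U, w u x := by omega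
    rw [h3]
    have := hy1 u hu
    have := hnn u U
    nlinarith
  have hG2 : ∑ r ∈ G, degreeExcess w (F r) ≤ degreeExcess w T₀ := by
    have : ∑ r ∈ G, degreeExcess w (F r) = degreeExcess w (G.biUnion F) :=
      (Finset.sum_biUnion hGd).symm
    rw [this]
    exact degreeExcess_mono hw (Finset.biUnion_subset.2 fun r _ => hFT r)
  have hG3 : G.card * L ≤ Fintype.card V := by
    calc G.card * L ≤ ∑ r ∈ G, (F r).card := by
          rw [← smul_eq_mul]
          exact Finset.card_nsmul_le_sum _ _ _ fun r hr => (Finset.mem_filter.1 hr).2.le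
      _ = (G.biUnion F).card := (Finset.card_biUnion hGd).symm
      _ ≤ _ := Finset.card_le_univ _
  have hG4 : (T₁.card : ℤ) * 2 ≤ degreeExcess w T₀ + G.card * 2 := by
    have h2 := Finset.sum_le_sum hG1
    simp only [Finset.sum_const, nsmul_eq_mul] at h2 hsum
    linarith
  have hcut : edgeWeight w R Rᶜ = T₁.card := by
    unfold edgeWeight
    have e : ∑ v ∈ T₁, ∑ u ∈ Rᶜ, w v u = ∑ v ∈ R, ∑ u ∈ Rᶜ, w v u :=
      Finset.sum_subset hT₁R fun v hv h => h0 v hv h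
    rw [← e, Finset.sum_congr rfl fun v hv => (h1 v hv).1]
    simp
  have hexc : degreeExcess w R = degreeExcess w T₀ + T₁.card := by
    conv_lhs => rw [← hTR, degreeExcess, Finset.sum_union hTd]
    congr 1
    rw [Finset.sum_congr rfl fun v hv => by
      rw [← hdeg v, (h1 v hv).1, (h1 v hv).2]]
    simp
  rw [hcut, hexc]
  have hG5 : (G.card : ℤ) * L ≤ Fintype.card V := by exact_mod_cast hG3
  nlinarith

end LocalImprovement

section Sweep

variable {V : Type*} [Fintype V] [DecidableEq V] {w : V → V → ℤ}

theorem edgeWeight_singleton_sdiff (hw : IsTwoThreeMultigraph w) {R : Finset V} {v : V}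
    (hv : v ∈ R) : edgeWeight w {v} (R \ {v}) = ∑ u ∈ R, w v u := by
  have h := Finset.sum_sdiff (f := fun u => w v u) (Finset.singleton_subset_iff.2 hv)
  simp only [Finset.sum_singleton, hw.irrefl, add_zero] at h
  simp [edgeWeight, h]

theorem degreeExcess_sdiff_add {R H : Finset V} (hH : H ⊆ R) :
    degreeExcess w (R \ H) + degreeExcess w H = degreeExcess w R :=
  Finset.sum_sdiff hH

theorem degreeExcess_add_compl (R : Finset V) :
    degreeExcess w R + degreeExcess w Rᶜ = degreeExcess w Finset.univ :=
  Finset.sum_add_sum_compl R _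

/-- There is a set containing about half of the vertices of degree 3 whose cut has size about one
sixth of the number of vertices of degree 3. -/
theorem exists_bisection (hw : IsTwoThreeMultigraph w) {L : ℕ} (hL : 1 ≤ L) :
    ∃ R : Finset V,
      3 * (L * edgeWeight w R Rᶜ) ≤ L * degreeExcess w R + 2 * Fintype.card V ∧
      2 * degreeExcess w R ≤ degreeExcess w Finset.univ + 2 * gainBound L ∧
      2 * degreeExcess w Rᶜ ≤ degreeExcess w Finset.univ := by
  have hB : (1 : ℤ) ≤ gainBound L := by exact_mod_cast one_le_gainBound hL
  set a := degreeExcess w Finset.univ with ha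
  let Half : Finset V → Prop := fun R =>
    a ≤ 2 * degreeExcess w R ∧ 2 * degreeExcess w R ≤ a + 2 * gainBound L
  have hne : ∃ R, Half R := by
    have ha0 : 0 ≤ a := degreeExcess_nonneg hw _
    obtain ⟨R, hR, hmin⟩ := Set.exists_min_image {R : Finset V | a ≤ 2 * degreeExcess w R}
      Finset.card (Set.toFinite _) ⟨Finset.univ, by simp only [Set.mem_ofPred_eq]; omega⟩
    refine ⟨R, hR, ?_⟩
    rcases R.eq_empty_or_nonempty with rfl | ⟨v, hv⟩
    · simp [degreeExcess]; omega
    · have h1 := degreeExcess_sdiff_add (w := w) (Finset.singleton_subset_iff.2 hv)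
      have h2 := degreeExcess_le_card hw {v}
      simp only [Finset.card_singleton, Nat.cast_one] at h2
      by_contra hlt
      have h3 := hmin (R \ {v}) (by simp only [Set.mem_ofPred_eq]; omega)
      have h4 := Finset.card_lt_card (Finset.sdiff_ssubset (Finset.singleton_subset_iff.2 hv)
        (Finset.singleton_nonempty v))
      omega
  obtain ⟨R, hR, hmin⟩ := Set.exists_min_image {R | Half R}
    (fun R => edgeWeight w R Rᶜ * (Fintype.card V + 1) + R.card) (Set.toFinite _) hne
  have hcutmin : ∀ R', Half R' → edgeWeight w R Rᶜ ≤ edgeWeight w R' R'ᶜ := by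
    intro R' hR'
    have h1 := hmin R' hR'
    have h2 : (R'.card : ℤ) ≤ Fintype.card V := by exact_mod_cast Finset.card_le_univ R'
    by_contra hlt
    nlinarith
  have hmove : ∀ H ⊆ R, H.card ≤ gainBound L →
      edgeWeight w H Rᶜ ≤ edgeWeight w H (R \ H) := by
    intro H hH hc
    by_contra hlt
    have h1 := edgeWeight_sdiff_compl hw.symm hH
    have h2 := degreeExcess_sdiff_add (w := w) hH
    have h3 := degreeExcess_le_card hw H
    have h4 : (H.card : ℤ) ≤ gainBound L := by exact_mod_cast hc
    have h5 := degreeExcess_nonneg hw H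
    have h6 := degreeExcess_add_compl (w := w) (R \ H)
    rcases le_or_gt a (2 * degreeExcess w (R \ H)) with h | h
    · have := hcutmin (R \ H) ⟨h, by linarith [hR.2]⟩
      omega
    · have := hcutmin (R \ H)ᶜ ⟨by omega, by linarith [hR.1, hR.2]⟩
      rw [edgeWeight_compl_comm hw.symm] at this
      omega
  refine ⟨R, edgeWeight_compl_le_of_no_gain hw hL R (fun v hv => ?_) hmove, hR.2, ?_⟩
  · by_contra hlt
    have hvR : {v} ⊆ R := Finset.singleton_subset_iff.2 hv
    have h1 := hmove {v} hvR (by simpa using one_le_gainBound hL)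
    rw [edgeWeight_singleton_sdiff hw hv] at h1
    have h2 : edgeWeight w {v} Rᶜ = ∑ u ∈ Rᶜ, w v u := by simp [edgeWeight]
    have h3 : ∑ u ∈ R, w v u + ∑ u ∈ Rᶜ, w v u = ∑ u, w v u := Finset.sum_add_sum_compl R _
    have h4 := degreeExcess_sdiff_add (w := w) hvR
    have h5 : degreeExcess w {v} = ∑ u, w v u - 2 := by simp [degreeExcess]
    have h6 : degreeExcess w {v} = 0 := by rcases hw.degree v with h | h <;> omega
    have h7 := hmin (R \ {v}) ⟨by linarith [hR.1], by linarith [hR.2]⟩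
    have h8 := edgeWeight_sdiff_compl hw.symm hvR
    rw [edgeWeight_singleton_sdiff hw hv] at h8
    have h9 : edgeWeight w (R \ {v}) (R \ {v})ᶜ = edgeWeight w R Rᶜ := by omega
    have h10 := Finset.card_lt_card (Finset.sdiff_ssubset hvR (Finset.singleton_nonempty v))
    simp only [h9] at h7
    omega
  · have := degreeExcess_add_compl (w := w) R
    linarith [hR.1]

/-- A set can be emptied by removing boundedly many vertices at a time without the cut ever
becoming large. -/
theorem exists_sweep (hw : IsTwoThreeMultigraph w) {L : ℕ} (hL : 1 ≤ L) (a W : ℤ)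
    (hW : L * a + 4 * Fintype.card V ≤ 6 * (L * (W - 3))) (R : Finset V)
    (hRa : 2 * degreeExcess w R ≤ a) (hRW : edgeWeight w R Rᶜ ≤ W) :
    ∃ (N : ℕ) (τ : V → ℕ), (∀ v, τ v < N) ∧
      (∀ t, (R.filter (τ · = t)).card ≤ gainBound L) ∧
      ∀ t, edgeWeight w (R.filter (t ≤ τ ·)) (R.filter (t ≤ τ ·))ᶜ ≤ W := by
  have hL0 : (0 : ℤ) < L := by exact_mod_cast hL
  induction R using Finset.strongInduction with
  | H R ih =>
    rcases R.eq_empty_or_nonempty with rfl | ⟨v₀, hv₀⟩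
    · exact ⟨1, fun _ => 0, by simp, by simp, by simpa using hRW⟩
    have hstep : ∃ H ⊆ R, H.Nonempty ∧ H.card ≤ gainBound L ∧
        edgeWeight w (R \ H) (R \ H)ᶜ ≤ W := by
      by_cases h1 : ∃ v ∈ R, ∑ u ∈ R, w v u ≤ ∑ u ∈ Rᶜ, w v u
      · obtain ⟨v, hv, h⟩ := h1
        have hvR : {v} ⊆ R := Finset.singleton_subset_iff.2 hv
        refine ⟨{v}, hvR, by simp, by simpa using one_le_gainBound hL, ?_⟩
        rw [edgeWeight_sdiff_compl hw.symm hvR, edgeWeight_singleton_sdiff hw hv]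
        have h2 : edgeWeight w {v} Rᶜ = ∑ u ∈ Rᶜ, w v u := by simp [edgeWeight]
        omega
      by_cases h2 : ∃ H ⊆ R, H.card ≤ gainBound L ∧ edgeWeight w H (R \ H) < edgeWeight w H Rᶜ
      · obtain ⟨H, hH, hc, hlt⟩ := h2
        refine ⟨H, hH, ?_, hc, ?_⟩
        · rw [Finset.nonempty_iff_ne_empty]
          rintro rfl
          simp [edgeWeight] at hlt
        · rw [edgeWeight_sdiff_compl hw.symm hH]; omega
      push Not at h1 h2
      have h3 := edgeWeight_compl_le_of_no_gain hw hL R h1 h2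
      have h4 : edgeWeight w R Rᶜ ≤ W - 3 := by
        have h5 : (L : ℤ) * (2 * degreeExcess w R) ≤ L * a := by gcongr
        have h6 : (L : ℤ) * edgeWeight w R Rᶜ ≤ L * (W - 3) := by linarith
        exact le_of_mul_le_mul_left h6 hL0
      have hvR : {v₀} ⊆ R := Finset.singleton_subset_iff.2 hv₀
      refine ⟨{v₀}, hvR, by simp, by simpa using one_le_gainBound hL, ?_⟩
      have h5 := edgeWeight_nonneg hw.nonneg {v₀} Rᶜ
      have h6 : edgeWeight w {v₀} (R \ {v₀}) ≤ 3 * ({v₀} : Finset V).card :=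
        (edgeWeight_mono hw.nonneg subset_rfl (Finset.subset_univ _)).trans
          (edgeWeight_univ_le hw _)
      simp only [Finset.card_singleton, Nat.cast_one] at h6
      rw [edgeWeight_sdiff_compl hw.symm hvR]
      omega
    obtain ⟨H, hH, hHne, hHc, hHW⟩ := hstep
    obtain ⟨N, τ, hτN, hτ1, hτ2⟩ := ih (R \ H) (Finset.sdiff_ssubset hH hHne)
      (by have := degreeExcess_mono hw (Finset.sdiff_subset : R \ H ⊆ R); omega) hHW
    refine ⟨N + 1, fun v => if v ∈ H then 0 else τ v + 1, fun v => ?_, fun t => ?_, fun t => ?_⟩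
    · have := hτN v
      dsimp only
      split_ifs <;> omega
    · rcases t with _ | t
      · refine (Finset.card_le_card fun v hv => ?_).trans hHc
        have := (Finset.mem_filter.1 hv).2
        by_contra h
        simp [h] at this
      · refine (Finset.card_le_card fun v hv => ?_).trans (hτ1 t)
        obtain ⟨hvR, h⟩ := Finset.mem_filter.1 hv
        dsimp only at h
        split_ifs at h with h'
        exact Finset.mem_filter.2 ⟨Finset.mem_sdiff.2 ⟨hvR, h'⟩, by omega⟩
    · rcases t with _ | t
      · simpa using hRW
      · have : R.filter (fun v => t + 1 ≤ if v ∈ H then 0 else τ v + 1) =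
            (R \ H).filter (t ≤ τ ·) := by
          ext v
          simp only [Finset.mem_filter, Finset.mem_sdiff]
          split_ifs with h <;> simp [h]
        rw [this]
        exact hτ2 t

/-- The vertices can be listed, boundedly many at a time, such that every initial part has a cut
of size about at most one sixth of the number of vertices of degree 3. -/
theorem exists_ordering (hw : IsTwoThreeMultigraph w) {L : ℕ} (hL : 1 ≤ L) (W : ℤ)
    (hW : L * (degreeExcess w Finset.univ + 2 * gainBound L) + 4 * Fintype.card V ≤
      6 * (L * (W - 3))) :
    ∃ τ : V → ℕ, (∀ t, (Finset.univ.filter (τ · = t)).card ≤ gainBound L) ∧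
      ∀ t, edgeWeight w (Finset.univ.filter (τ · < t)) (Finset.univ.filter (τ · < t))ᶜ ≤ W := by
  have hL0 : (0 : ℤ) < L := by exact_mod_cast hL
  obtain ⟨R, h1, h2, h3⟩ := exists_bisection hw hL
  have hRW : edgeWeight w R Rᶜ ≤ W := by
    have h5 : (L : ℤ) * (2 * degreeExcess w R) ≤
        L * (degreeExcess w Finset.univ + 2 * gainBound L) := by gcongr
    have h6 : (L : ℤ) * edgeWeight w R Rᶜ ≤ L * (W - 3) := by linarith
    have := le_of_mul_le_mul_left h6 hL0
    omega
  obtain ⟨N₁, τ₁, hN₁, hτ₁, hW₁⟩ := exists_sweep hw hL _ W hW R h2 hRW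
  obtain ⟨N₂, τ₂, hN₂, hτ₂, hW₂⟩ := exists_sweep hw hL _ W hW Rᶜ (by omega)
    (by rwa [edgeWeight_compl_comm hw.symm])
  refine ⟨fun v => if v ∈ R then N₂ + τ₁ v else N₂ - 1 - τ₂ v, fun t => ?_, fun t => ?_⟩
  · rcases le_or_gt N₂ t with ht | ht
    · refine (Finset.card_le_card fun v hv => ?_).trans (hτ₁ (t - N₂))
      have h := (Finset.mem_filter.1 hv).2
      have := hN₂ v
      dsimp only at h
      split_ifs at h with h'
      · exact Finset.mem_filter.2 ⟨h', by omega⟩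
      · omega
    · refine (Finset.card_le_card fun v hv => ?_).trans (hτ₂ (N₂ - 1 - t))
      have h := (Finset.mem_filter.1 hv).2
      have := hN₂ v
      dsimp only at h
      split_ifs at h with h'
      · omega
      · exact Finset.mem_filter.2 ⟨Finset.mem_compl.2 h', by omega⟩
  · rcases le_or_gt N₂ t with ht | ht
    · have : Finset.univ.filter
          (fun v => (if v ∈ R then N₂ + τ₁ v else N₂ - 1 - τ₂ v) < t) =
          (R.filter (t - N₂ ≤ τ₁ ·))ᶜ := by
        ext v
        have := hN₂ v
        simp only [Finset.mem_filter, Finset.mem_univ, true_and, Finset.mem_compl, not_and]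
        split_ifs with h
        · simp only [h, forall_const]; omega
        · simp only [h, false_imp_iff, iff_true]; omega
      rw [this, edgeWeight_compl_comm hw.symm]
      exact hW₁ _
    · have : Finset.univ.filter
          (fun v => (if v ∈ R then N₂ + τ₁ v else N₂ - 1 - τ₂ v) < t) =
          Rᶜ.filter (N₂ - t ≤ τ₂ ·) := by
        ext v
        have := hN₂ v
        simp only [Finset.mem_filter, Finset.mem_univ, true_and, Finset.mem_compl]
        split_ifs with h
        · simp only [h, not_true_eq_false, false_and, iff_false]; omega
        · simp only [h, not_false_eq_true, true_and]; omega
      rw [this]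
      exact hW₂ _

end Sweep

/-- A path decomposition of a contraction of a multigraph from a linear layout of the multigraph. -/
theorem pathwidthAtMost_of_ordering {V W : Type*} [Fintype V] [DecidableEq V] [DecidableEq W]
    {w : V → V → ℤ} (hw : IsTwoThreeMultigraph w) (G : SimpleGraph W) (h : V → W)
    (hsurj : Function.Surjective h) (hfib : ∀ u v, h u = h v → u = v ∨ 0 < w u v)
    (hadj : ∀ x y, G.Adj x y → ∃ u v, h u = x ∧ h v = y ∧ 0 < w u v)
    (τ : V → ℕ) (B : ℕ) (c : ℤ) (hB : ∀ t, (Finset.univ.filter (τ · = t)).card ≤ B)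
    (hc : ∀ t, edgeWeight w (Finset.univ.filter (τ · < t)) (Finset.univ.filter (τ · < t))ᶜ ≤ c)
    (p : ℝ) (hp : (B : ℝ) + c ≤ p + 1) : PathwidthAtMost G p := by
  classical
  obtain ⟨r, hr⟩ : ∃ r, ∀ v, τ v < r :=
    ⟨Finset.univ.sup τ + 1, fun v => Nat.lt_succ_of_le (Finset.le_sup (Finset.mem_univ v))⟩
  let Y : ℕ → Finset V := fun t =>
    Finset.univ.filter (fun v => τ v ≤ t ∧ ∃ u, (u = v ∨ 0 < w v u) ∧ t ≤ τ u)
  have hself : ∀ v, v ∈ Y (τ v) := fun v => by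
    simp only [Y, Finset.mem_filter, Finset.mem_univ, true_and]
    exact ⟨le_rfl, v, Or.inl rfl, le_rfl⟩
  have hedge : ∀ u v, 0 < w u v → ∃ t : Fin r, u ∈ Y t ∧ v ∈ Y t := by
    intro u v huv
    rcases le_total (τ u) (τ v) with hle | hle
    · refine ⟨⟨τ v, hr v⟩, ?_, hself v⟩
      simp only [Y, Finset.mem_filter, Finset.mem_univ, true_and]
      exact ⟨hle, v, Or.inr huv, le_rfl⟩
    · refine ⟨⟨τ u, hr u⟩, hself u, ?_⟩
      simp only [Y, Finset.mem_filter, Finset.mem_univ, true_and]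
      exact ⟨hle, u, Or.inr (by rwa [hw.symm]), le_rfl⟩
  refine ⟨r, fun t => (Y t).image h, fun x => ?_, fun e he => ?_,
    fun x t₁ t₂ t₃ h12 h23 h1 h3 => ?_, fun t => ?_⟩
  · obtain ⟨v, rfl⟩ := hsurj x
    exact ⟨⟨τ v, hr v⟩, Finset.mem_image_of_mem h (hself v)⟩
  · induction e using Sym2.ind with
    | _ x y =>
      obtain ⟨u, v, rfl, rfl, huv⟩ := hadj x y he
      obtain ⟨t, hu, hv⟩ := hedge u v huv
      refine ⟨t, fun z hz => ?_⟩
      rcases Sym2.mem_iff.1 hz with rfl | rfl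
      · exact Finset.mem_image_of_mem h hu
      · exact Finset.mem_image_of_mem h hv
  · obtain ⟨v₁, hv₁, rfl⟩ := Finset.mem_image.1 h1
    obtain ⟨v₂, hv₂, hv⟩ := Finset.mem_image.1 h3
    have h12' : (t₁ : ℕ) ≤ t₂ := h12
    have h23' : (t₂ : ℕ) ≤ t₃ := h23
    simp only [Y, Finset.mem_filter, Finset.mem_univ, true_and] at hv₁ hv₂
    obtain ⟨ha, -⟩ := hv₁
    obtain ⟨-, u, hu, hb⟩ := hv₂
    simp only [Finset.mem_image, Y, Finset.mem_filter, Finset.mem_univ, true_and]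
    rcases le_or_gt (τ v₂) t₂ with hle | hlt
    · exact ⟨v₂, ⟨hle, u, hu, h23'.trans hb⟩, hv⟩
    · exact ⟨v₁, ⟨ha.trans h12', v₂, by
        rcases hfib v₁ v₂ hv.symm with h | h
        · exact Or.inl h.symm
        · exact Or.inr h, hlt.le⟩, rfl⟩
  · have hsub : Y t ⊆ Finset.univ.filter (τ · = (t : ℕ)) ∪
        (Finset.univ.filter (τ · < (t : ℕ))).filter
          (fun v => ∃ u ∈ (Finset.univ.filter (τ · < (t : ℕ)))ᶜ, 0 < w u v) := by
      intro v hv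
      simp only [Y, Finset.mem_filter, Finset.mem_univ, true_and] at hv
      obtain ⟨hle, u, hu, hut⟩ := hv
      simp only [Finset.mem_union, Finset.mem_filter, Finset.mem_univ, true_and,
        Finset.mem_compl, not_lt]
      rcases hle.eq_or_lt with heq | hlt
      · exact Or.inl heq
      · refine Or.inr ⟨hlt, u, hut, ?_⟩
        rcases hu with rfl | hu
        · omega
        · rwa [hw.symm]
    have h1 : (((Finset.univ.filter (τ · < (t : ℕ))).filter
          (fun v => ∃ u ∈ (Finset.univ.filter (τ · < (t : ℕ)))ᶜ, 0 < w u v)).card : ℤ) ≤ c := by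
      refine le_trans ?_ (hc t)
      set S := Finset.univ.filter (τ · < (t : ℕ))
      calc _ = ∑ v ∈ S.filter (fun v => ∃ u ∈ Sᶜ, 0 < w u v), (1 : ℤ) := by simp
        _ ≤ ∑ v ∈ S.filter (fun v => ∃ u ∈ Sᶜ, 0 < w u v), ∑ u ∈ Sᶜ, w v u := by
          refine Finset.sum_le_sum fun v hv => ?_
          obtain ⟨u, hu, huv⟩ := (Finset.mem_filter.1 hv).2
          rw [hw.symm] at huv
          exact (Int.add_one_le_iff.2 huv).trans
            (Finset.single_le_sum (f := fun x => w v x) (fun x _ => hw.nonneg v x) hu)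
        _ ≤ _ := edgeWeight_mono hw.nonneg (Finset.filter_subset _ _) subset_rfl
    have h2 : ((Y t).card : ℤ) ≤ B + c := by
      have h3 := (Finset.card_le_card hsub).trans (Finset.card_union_le _ _)
      have h4 := hB t
      omega
    have h3 : (((Y t).image h).card : ℤ) ≤ B + c := by
      have := Finset.card_image_le (s := Y t) (f := h)
      omega
    refine le_trans ?_ hp
    exact_mod_cast h3

section Pattern

/-- The vertex of `[k]` that a vertex of `[2k]` is identified into. -/
def halve {k : ℕ} (v : Fin (2 * k)) : Fin k := ⟨v.val / 2, by omega⟩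

/-- The pairs of consecutive vertices of `[2k]` that lie above an element of `A`. -/
def IsLift {k : ℕ} (A : Finset (Sym2 (Fin k))) (u v : Fin (2 * k)) : Prop :=
  s(halve u, halve v) ∈ A ∧
    ((u.val % 2 = 1 ∧ v.val = u.val + 1) ∨ (v.val % 2 = 1 ∧ u.val = v.val + 1))

open Classical in
/-- The multigraph on `[2k]` consisting of `M`, the pairs contracted by `halve`, and the lift
of `A`. -/
noncomputable def patternWeight {k : ℕ} (M : Set (Sym2 (Fin (2 * k)))) (A : Finset (Sym2 (Fin k)))
    (u v : Fin (2 * k)) : ℤ :=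
  (if s(u, v) ∈ M then 1 else 0) + (if u ≠ v ∧ halve u = halve v then 1 else 0) +
    (if IsLift A u v then 1 else 0)

variable {k : ℕ} {M : Set (Sym2 (Fin (2 * k)))} {A : Finset (Sym2 (Fin k))}

theorem halve_surjective : Function.Surjective (halve : Fin (2 * k) → Fin k) := fun i =>
  ⟨⟨2 * i.val, by omega⟩, Fin.ext (by simp [halve])⟩

theorem isLift_comm {u v : Fin (2 * k)} : IsLift A u v ↔ IsLift A v u := by
  unfold IsLift
  rw [Sym2.eq_swap, or_comm]

theorem IsLift.right_unique {u v v' : Fin (2 * k)} (h : IsLift A u v) (h' : IsLift A u v') :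
    v = v' := by
  have h1 := h.2
  have h2 := h'.2
  ext
  omega

theorem sum_ite_eq_one_of_existsUnique {ι : Type*} [Fintype ι] {P : ι → Prop} [DecidablePred P]
    (h : ∃! i, P i) : ∑ i, (if P i then (1 : ℤ) else 0) = 1 := by
  classical
  obtain ⟨i, hi, hu⟩ := h
  rw [Finset.sum_eq_single i (fun j _ hj => if_neg fun h => hj (hu j h))
    (fun h => absurd (Finset.mem_univ i) h), if_pos hi]

theorem existsUnique_mem_of_isPerfectMatching (hM : IsPerfectMatchingEdgeSet M) (u : Fin (2 * k)) :
    ∃! v, s(u, v) ∈ M := by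
  obtain ⟨e, ⟨he, hue⟩, hu⟩ := hM.2 u
  obtain ⟨v, rfl⟩ := hue
  refine ⟨v, he, fun v' hv' => ?_⟩
  exact Sym2.congr_right.1 (hu _ ⟨hv', Sym2.mem_mk_left _ _⟩)

theorem existsUnique_halve_eq (u : Fin (2 * k)) : ∃! v, u ≠ v ∧ halve u = halve v := by
  simp only [halve, ne_eq, Fin.ext_iff]
  refine ⟨⟨u.val / 2 * 2 + (1 - u.val % 2), by omega⟩, by dsimp only; omega, fun v hv => ?_⟩
  ext
  dsimp only
  omega

open Classical in
theorem sum_patternWeight (hM : IsPerfectMatchingEdgeSet M) (u : Fin (2 * k)) :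
    ∑ v, patternWeight M A u v = 2 + ∑ v, if IsLift A u v then 1 else 0 := by
  simp only [patternWeight, Finset.sum_add_distrib]
  rw [sum_ite_eq_one_of_existsUnique (existsUnique_mem_of_isPerfectMatching hM u),
    sum_ite_eq_one_of_existsUnique (existsUnique_halve_eq u)]
  rfl

theorem isTwoThreeMultigraph_patternWeight (hM : IsPerfectMatchingEdgeSet M) :
    IsTwoThreeMultigraph (patternWeight M A) where
  symm u v := by
    classical
    unfold patternWeight
    exact congrArg₂ _ (congrArg₂ _ (if_congr (by rw [Sym2.eq_swap]) rfl rfl)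
      (if_congr (by rw [ne_comm, eq_comm (a := halve u)]) rfl rfl)) (if_congr isLift_comm rfl rfl)
  nonneg u v := by
    unfold patternWeight
    split_ifs <;> norm_num
  irrefl v := by
    have h1 : s(v, v) ∉ M := fun h => hM.1 _ h (Sym2.mk_isDiag_iff.2 rfl)
    have h2 : ¬ IsLift A v v := fun h => by have := h.2; omega
    simp [patternWeight, h1, h2]
  degree u := by
    classical
    rw [sum_patternWeight hM]
    by_cases h : ∃ v, IsLift A u v
    · obtain ⟨v, hv⟩ := h
      right
      rw [sum_ite_eq_one_of_existsUnique ⟨v, hv, fun v' hv' => hv'.right_unique hv⟩]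
      norm_num
    · left
      push Not at h
      simp [h]

theorem degreeExcess_patternWeight_le (hM : IsPerfectMatchingEdgeSet M) :
    degreeExcess (patternWeight M A) Finset.univ ≤ 2 * A.card := by
  classical
  have h1 : degreeExcess (patternWeight M A) Finset.univ =
      ((Finset.univ.filter fun p : Fin (2 * k) × Fin (2 * k) => IsLift A p.1 p.2).card : ℤ) := by
    simp only [degreeExcess, sum_patternWeight hM, add_sub_cancel_left]
    rw [← Finset.sum_product', Finset.univ_product_univ, Finset.sum_boole]
  have h2 : (Finset.univ.filter fun p : Fin (2 * k) × Fin (2 * k) => IsLift A p.1 p.2).card ≤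
      (A ×ˢ (Finset.univ : Finset Bool)).card := by
    refine Finset.card_le_card_of_injOn
      (fun p => (s(halve p.1, halve p.2), decide (p.1.val % 2 = 1))) (fun p hp => ?_) ?_
    · have := (Finset.mem_filter.1 hp).2.1
      exact Finset.mem_coe.2 (Finset.mem_product.2 ⟨this, Finset.mem_univ _⟩)
    · rintro ⟨u, v⟩ hp ⟨u', v'⟩ hp' heq
      have h := (Finset.mem_filter.1 hp).2.2
      have h' := (Finset.mem_filter.1 hp').2.2
      simp only [Prod.mk.injEq, decide_eq_decide, Sym2.eq_iff, halve, Fin.ext_iff] at heq h h'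
      ext <;> dsimp only <;> omega
  rw [h1]
  simp only [Finset.card_product, Finset.card_univ, Fintype.card_bool] at h2
  omega

theorem exists_patternWeight_pos_of_adj (hA : (A : Set (Sym2 (Fin k))) ⊆ Pk k) {x y : Fin k}
    (h : (SimpleGraph.fromEdgeSet (IM k M ∪ ↑A)).Adj x y) :
    ∃ u v, halve u = x ∧ halve v = y ∧ 0 < patternWeight M A u v := by
  have hpos : ∀ {u v}, s(u, v) ∈ M ∨ IsLift A u v → 0 < patternWeight M A u v := by
    intro u v h
    unfold patternWeight
    rcases h with h | h <;> simp only [h, if_true] <;> split_ifs <;> norm_num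
  rw [SimpleGraph.fromEdgeSet_adj] at h
  rcases h.1 with ⟨-, e, he, hxy⟩ | hxyA
  · induction e using Sym2.ind with
    | _ u v =>
      rw [Sym2.map_mk, Sym2.eq_iff] at hxy
      rcases hxy with ⟨h1, h2⟩ | ⟨h1, h2⟩
      · exact ⟨u, v, h1, h2, hpos (Or.inl he)⟩
      · exact ⟨v, u, h2, h1, hpos (Or.inl (by rwa [Sym2.eq_swap]))⟩
  · obtain ⟨i, hi, hxy⟩ := hA hxyA
    have hu : halve (⟨2 * i + 1, by omega⟩ : Fin (2 * k)) = ⟨i, by omega⟩ :=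
      Fin.ext (by simp only [halve]; omega)
    have hv : halve (⟨2 * i + 2, by omega⟩ : Fin (2 * k)) = ⟨i + 1, hi⟩ :=
      Fin.ext (by simp only [halve]; omega)
    have hl : IsLift A (⟨2 * i + 1, by omega⟩ : Fin (2 * k)) ⟨2 * i + 2, by omega⟩ := by
      refine ⟨?_, Or.inl (by dsimp only; omega)⟩
      rw [hu, hv, ← hxy]
      exact hxyA
    rw [Sym2.eq_iff] at hxy
    rcases hxy with ⟨rfl, rfl⟩ | ⟨rfl, rfl⟩
    · exact ⟨_, _, hu, hv, hpos (Or.inr hl)⟩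
    · exact ⟨_, _, hv, hu, hpos (Or.inr (isLift_comm.1 hl))⟩

theorem pathwidthAtMost_pattern (hM : IsPerfectMatchingEdgeSet M)
    (hA : (A : Set (Sym2 (Fin k))) ⊆ Pk k) {L : ℕ} (hL : 1 ≤ L) {p : ℝ}
    (hp : (A.card : ℝ) / 3 + 4 * k / (3 * L) + (4 * gainBound L + 4) ≤ p) :
    PathwidthAtMost (SimpleGraph.fromEdgeSet (IM k M ∪ ↑A)) p := by
  classical
  have hw := isTwoThreeMultigraph_patternWeight (A := A) hM
  have hL0 : (0 : ℤ) < L := by exact_mod_cast hL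
  have hLR : (0 : ℝ) < L := by exact_mod_cast hL
  have hexc := degreeExcess_patternWeight_le (A := A) hM
  set a : ℤ := degreeExcess (patternWeight M A) Finset.univ
  set S : ℤ := L * (a + 2 * gainBound L) + 4 * Fintype.card (Fin (2 * k)) with hS
  set W : ℤ := 4 + S / (6 * L) with hWdef
  have hmod := Int.emod_add_mul_ediv S (6 * L)
  have hW : S ≤ 6 * (L * (W - 3)) := by
    have := Int.emod_lt_of_pos S (by omega : (0 : ℤ) < 6 * L)
    rw [hWdef]
    linarith
  have hW' : 6 * (L * (W - 4)) ≤ S := by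
    have := Int.emod_nonneg S (by omega : (6 * L : ℤ) ≠ 0)
    rw [hWdef]
    linarith
  obtain ⟨τ, h1, h2⟩ := exists_ordering hw hL W hW
  refine pathwidthAtMost_of_ordering hw _ halve halve_surjective (fun u v huv => ?_)
    (fun x y => exists_patternWeight_pos_of_adj hA) τ _ W h1 h2 p ?_
  · by_cases h : u = v
    · exact Or.inl h
    · right
      unfold patternWeight
      rw [if_pos (⟨h, huv⟩ : u ≠ v ∧ halve u = halve v)]
      split_ifs <;> norm_num
  · have h3 : (6 : ℝ) * (L * (W - 4)) ≤ L * (2 * A.card + 2 * gainBound L) + 8 * k := by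
      have h4 : 6 * (L * (W - 4)) ≤ L * (2 * A.card + 2 * gainBound L) + 8 * (k : ℤ) := by
        have h5 : (L : ℤ) * (a + 2 * gainBound L) ≤ L * (2 * A.card + 2 * gainBound L) := by
          gcongr
        rw [Fintype.card_fin] at hS
        push_cast at hS
        linarith
      exact_mod_cast h4
    have h6 : (W : ℝ) ≤ 4 + ((A.card : ℝ) / 3 + gainBound L / 3 + 4 * k / (3 * L)) := by
      have h7 : (L : ℝ) * (W - 4) ≤
          L * ((A.card : ℝ) / 3 + gainBound L / 3 + 4 * k / (3 * L)) := by
        have h8 : (L : ℝ) * (4 * k / (3 * L)) = 4 * k / 3 := by field_simp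
        rw [mul_add, h8]
        linarith
      have := le_of_mul_le_mul_left h7 hLR
      linarith
    have h9 : (0 : ℝ) ≤ gainBound L := Nat.cast_nonneg _
    linarith

end Pattern

/-- A bound of the form `c / L + C L / k` can be made to tend to zero with `k` by choosing `L`. -/
theorem exists_tendsto_zero_of_tradeoff (C : ℕ → ℕ) {c : ℝ} (hc : 0 ≤ c) :
    ∃ ε : ℕ → ℝ, (∀ k, 0 ≤ ε k) ∧ Filter.Tendsto ε Filter.atTop (nhds 0) ∧
      ∀ k, 0 < k → ∃ L, 1 ≤ L ∧ c * k / L + C L ≤ ε k * k := by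
  let ℓ : ℕ → ℕ := fun k => Nat.findGreatest (fun L => L * C (L + 1) ≤ k) k
  have hℓ : ∀ k, ℓ k * C (ℓ k + 1) ≤ k := fun k =>
    Nat.findGreatest_spec (P := fun L => L * C (L + 1) ≤ k) (Nat.zero_le k) (by simp)
  have htop : Filter.Tendsto ℓ Filter.atTop Filter.atTop := by
    refine Filter.tendsto_atTop.2 fun N => ?_
    filter_upwards [Filter.eventually_ge_atTop (max N (N * C (N + 1)))] with k hk
    exact Nat.le_findGreatest ((le_max_left _ _).trans hk) ((le_max_right _ _).trans hk)
  refine ⟨fun k => c / (ℓ k + 1 : ℕ) + C (ℓ k + 1) / k, fun k => by positivity, ?_, fun k hk =>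
    ⟨ℓ k + 1, by omega, le_of_eq ?_⟩⟩
  · rw [← add_zero (0 : ℝ)]
    refine Filter.Tendsto.add ?_ ?_
    · exact (tendsto_const_div_atTop_nhds_zero_nat c).comp
        ((Filter.tendsto_add_atTop_nat 1).comp htop)
    · refine squeeze_zero' (Filter.Eventually.of_forall fun k => by positivity) ?_
        ((tendsto_const_div_atTop_nhds_zero_nat (1 : ℝ)).comp htop)
      filter_upwards [Filter.eventually_gt_atTop 0, htop.eventually_gt_atTop 0] with k hk hk'
      have h1 : (0 : ℝ) < k := by exact_mod_cast hk
      have h2 : (0 : ℝ) < ℓ k := by exact_mod_cast hk'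
      rw [Function.comp_apply, div_le_div_iff₀ h1 h2, one_mul, mul_comm]
      exact_mod_cast hℓ k
  · have h1 : (k : ℝ) ≠ 0 := by positivity
    field_simp

/-- There is a sequence `(ε_k)` of nonnegative reals tending to 0
such that for every `k ≥ 2`, every valid connection `k`-pattern `M` and every
`A ⊆ P_k`, the pathwidth of `([k], I_M ∪ A)` is at most `|A|/3 + ε_k·k`. -/
theorem stmt_5 :
    ∃ ε : ℕ → ℝ, (∀ k, 0 ≤ ε k) ∧ Filter.Tendsto ε Filter.atTop (nhds 0) ∧
      ∀ (k : ℕ), 2 ≤ k → ∀ (M : Set (Sym2 (Fin (2 * k)))), IsValidPattern k M →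
        ∀ A : Finset (Sym2 (Fin k)), ↑A ⊆ Pk k →
          PathwidthAtMost (SimpleGraph.fromEdgeSet (IM k M ∪ ↑A))
            ((A.card : ℝ) / 3 + ε k * (k : ℝ)) := by
  obtain ⟨ε, h0, hlim, h⟩ := exists_tendsto_zero_of_tradeoff (fun L => 4 * gainBound L + 4)
    (by norm_num : (0 : ℝ) ≤ 4 / 3)
  refine ⟨ε, h0, hlim, fun k hk M hM A hA => ?_⟩
  obtain ⟨L, hL, hle⟩ := h k (by omega)
  refine pathwidthAtMost_pattern hM.1 hA hL ?_
  have h1 : (4 : ℝ) * k / (3 * L) = 4 / 3 * k / L := by field_simp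
  push_cast at hle
  linarith
end

section
/- Let (G, w) be a complete graph on vertices v_1,…,v_n with integer edge weights and let (G', w', C) be the instance constructed from it as described. Then G contains a triangle v_i, v_j, v_k with w(v_i,v_j) + w(v_j,v_k) + w(v_i,v_k) < 0 if and only if there exists an improving 4-move for the Hamiltonian cycle C in (G', w'). -/
/-- The vertex set of `G'`: `(i, 0) = a_{i+1}`, `(i, 1) = b_{i+1}`,
`(i, 2) = a'_{i+1}`, `(i, 3) = b'_{i+1}` (0-indexed `i : Fin n`). -/
abbrev Vp (n : ℕ) := Fin n × Fin 4

/-- The vertex sequence of the Hamiltonian cycle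
`C = a_1, b_1, …, a_n, b_n, b_n', a_n', …, b_1', a_1'`. -/
def cSeq (n : ℕ) (t : Fin (4 * n)) : Vp n :=
  if h : t.val < 2 * n then
    (⟨t.val / 2, by omega⟩, if t.val % 2 = 0 then 0 else 1)
  else
    (⟨(4 * n - 1 - t.val) / 2, by have := t.isLt; omega⟩,
      if (4 * n - 1 - t.val) % 2 = 0 then 2 else 3)

/-- The edge set of the Hamiltonian cycle `C`. -/
def cEdges (n : ℕ) : Set (Sym2 (Vp n)) :=
  { e | ∃ t : Fin (4 * n),
      e = s(cSeq n t, cSeq n ⟨(t.val + 1) % (4 * n), Nat.mod_lt _ (by have := t.isLt; omega)⟩) }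

/-- `E` is the edge set of a Hamiltonian cycle (of the complete graph on `V`). -/
def IsHamCycleEdgeSet {V : Type*} [Fintype V] [DecidableEq V] (E : Set (Sym2 V)) : Prop :=
  ∃ (u : V) (p : (SimpleGraph.fromEdgeSet E).Walk u u),
    p.IsHamiltonianCycle ∧ ∀ e, e ∈ E ↔ e ∈ p.edges

/-- `M₁ = 5W + 1`. -/
def M1 (W : ℤ) : ℤ := 5 * W + 1

/-- `M₂ = 21·M₁ + 1`. -/
def M2 (W : ℤ) : ℤ := 21 * M1 W + 1

/-- The pairs of vertices of `G'` whose weight is given by one of the explicit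
cases in the definition of `w'` (all remaining pairs get weight `M₂`). -/
def SpecialPair (n : ℕ) (hn : 0 < n) (e : Sym2 (Vp n)) : Prop :=
  (∃ i : Fin n, e = s((i, 0), (i, 3))) ∨
  (∃ i j : Fin n, i < j ∧ e = s((i, 0), (j, 1))) ∨
  (∃ i j : Fin n, j < i ∧ e = s((i, 2), (j, 1))) ∨
  (∃ i : Fin n, e = s((i, 0), (i, 1))) ∨
  (∃ i : Fin n, e = s((i, 2), (i, 3))) ∨
  (∃ i j : Fin n, (i : ℕ) + 1 = (j : ℕ) ∧ (e = s((i, 1), (j, 0)) ∨ e = s((i, 3), (j, 2)))) ∨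
  e = s(((⟨0, hn⟩ : Fin n), 0), ((⟨0, hn⟩ : Fin n), 2)) ∨
  e = s(((⟨n - 1, by omega⟩ : Fin n), 1), ((⟨n - 1, by omega⟩ : Fin n), 3))

/-- `w'` is the weight function of the constructed instance `(G', w', C)`. -/
def IsReductionWeight (n : ℕ) (hn : 0 < n) (w : Sym2 (Fin n) → ℤ) (W : ℤ)
    (w' : Sym2 (Vp n) → ℤ) : Prop :=
  (∀ i : Fin n, w' s((i, 0), (i, 3)) = 0) ∧
  (∀ i j : Fin n, i < j → w' s((i, 0), (j, 1)) = w s(i, j)) ∧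
  (∀ i j : Fin n, j < i → w' s((i, 2), (j, 1)) = w s(i, j)) ∧
  (∀ i : Fin n, w' s((i, 0), (i, 1)) = M1 W) ∧
  (∀ i : Fin n, w' s((i, 2), (i, 3)) = -3 * M1 W) ∧
  (∀ i j : Fin n, (i : ℕ) + 1 = (j : ℕ) →
    w' s((i, 1), (j, 0)) = -(M2 W) ∧ w' s((i, 3), (j, 2)) = -(M2 W)) ∧
  (w' s(((⟨0, hn⟩ : Fin n), 0), ((⟨0, hn⟩ : Fin n), 2)) = -(M2 W)) ∧
  (w' s(((⟨n - 1, by omega⟩ : Fin n), 1), ((⟨n - 1, by omega⟩ : Fin n), 3)) = -(M2 W)) ∧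
  (∀ e : Sym2 (Vp n), ¬ SpecialPair n hn e → w' e = M2 W)

/-- `(Em, Ep)` is an improving `4`-move for the tour `C` in `(G', w')`. -/
def IsImproving4Move (n : ℕ) (w' : Sym2 (Vp n) → ℤ) (Em Ep : Set (Sym2 (Vp n))) : Prop :=
  Em.ncard = 4 ∧ Ep.ncard = 4 ∧ Em ⊆ cEdges n ∧ (∀ e ∈ Ep, ¬ e.IsDiag) ∧
    IsHamCycleEdgeSet ((cEdges n \ Em) ∪ Ep) ∧
    (∑ᶠ e ∈ ((cEdges n \ Em) ∪ Ep), w' e) < ∑ᶠ e ∈ cEdges n, w' e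

theorem isHamCycleEdgeSet_of_bijective {V : Type*} [Fintype V] [DecidableEq V] {m : ℕ}
    (hm : 3 ≤ m) (f : Fin m → V) (hf : Function.Bijective f) :
    IsHamCycleEdgeSet { e | ∃ t : Fin m,
      e = s(f t, f ⟨(t.val + 1) % m, Nat.mod_lt _ (by omega)⟩) } := by
  obtain ⟨k, rfl⟩ : ∃ k, m = k + 3 := ⟨m - 3, by omega⟩
  set E : Set (Sym2 V) := { e | ∃ t : Fin (k + 3),
      e = s(f t, f ⟨(t.val + 1) % (k + 3), Nat.mod_lt _ (by omega)⟩) } with hE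
  have hsucc : ∀ t : Fin (k + 3), (⟨(t.val + 1) % (k + 3), Nat.mod_lt _ (by omega)⟩ :
      Fin (k + 3)) = t + 1 := fun t => Fin.ext (by simp [Fin.val_add])
  simp only [hsucc] at hE
  let φ : SimpleGraph.cycleGraph (k + 3) →g SimpleGraph.fromEdgeSet E :=
    { toFun := f
      map_rel' := by
        intro a b hab
        rw [SimpleGraph.fromEdgeSet_adj]
        refine ⟨?_, fun h => hab.ne (hf.injective h)⟩
        rw [SimpleGraph.cycleGraph_adj] at hab
        rw [hE]
        rcases hab with h | h
        · exact ⟨b, by rw [Sym2.eq_swap, ← h]; simp⟩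
        · exact ⟨a, by rw [← h]; simp⟩ }
  have hcyc : (SimpleGraph.cycleGraph.cycle k).IsHamiltonianCycle :=
    SimpleGraph.Walk.isHamiltonianCycle_iff_isCycle_and_length_eq.2
      ⟨SimpleGraph.cycleGraph.isCycle_cycle, by simp⟩
  refine ⟨_, (SimpleGraph.cycleGraph.cycle k).map φ, hcyc.map (f := φ) hf, fun e => ⟨?_, ?_⟩⟩
  · intro he
    obtain ⟨t, rfl⟩ := hE ▸ he
    rw [SimpleGraph.Walk.edges_map]
    refine List.mem_map.2 ⟨s(t, t + 1), ?_, rfl⟩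
    rw [SimpleGraph.Walk.mk_mem_edges_iff_exists]
    refine ⟨k + 3 - (t + 1), by simp; omega, ?_⟩
    rw [SimpleGraph.cycleGraph.getVert_cycle (by omega), SimpleGraph.cycleGraph.getVert_cycle
      (by omega), Sym2.eq_swap]
    refine congrArg₂ (fun a b => s(a, b)) (Fin.ext ?_) (Fin.ext ?_)
    · simp only
      rw [Nat.mod_eq_of_lt (by omega)]
      omega
    · simp only [Fin.val_add, Fin.val_one]
      congr 1
      omega
  · intro he
    have := SimpleGraph.Walk.edges_subset_edgeSet _ he
    rw [SimpleGraph.edgeSet_fromEdgeSet] at this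
    exact this.1

theorem IsHamCycleEdgeSet.ncard_neighbors {V : Type*} [Fintype V] [DecidableEq V]
    {E : Set (Sym2 V)} (hE : IsHamCycleEdgeSet E) (v : V) : {u | s(v, u) ∈ E}.ncard = 2 := by
  obtain ⟨u, p, hp, hE⟩ := hE
  rw [← hp.isCycle.ncard_neighborSet_toSubgraph_eq_two (hp.mem_support v)]
  congr 1
  ext x
  simp [hE, SimpleGraph.Walk.adj_toSubgraph_iff_mem_edges]

theorem cSeq_bijective (n : ℕ) : Function.Bijective (cSeq n) := by
  rw [Fintype.bijective_iff_injective_and_card]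
  refine ⟨?_, by simp [mul_comm]⟩
  intro s t h
  ext
  have := s.isLt
  have := t.isLt
  unfold cSeq at h
  split_ifs at h <;> simp [Prod.ext_iff, Fin.ext_iff] at h <;> omega

theorem cSeq_a {n : ℕ} (i : Fin n) : cSeq n ⟨2 * i, by omega⟩ = (i, 0) := by
  simp [cSeq]

theorem cSeq_b {n : ℕ} (i : Fin n) : cSeq n ⟨2 * i + 1, by omega⟩ = (i, 1) := by
  have : 2 * (i : ℕ) + 1 < 2 * n := by omega
  simp [cSeq, this, Prod.ext_iff, Fin.ext_iff]
  omega

theorem cSeq_a' {n : ℕ} (i : Fin n) : cSeq n ⟨4 * n - 1 - 2 * i, by omega⟩ = (i, 2) := by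
  have h1 : ¬ (4 * n - 1 - 2 * (i : ℕ) < 2 * n) := by omega
  have h2 : 4 * n - 1 - (4 * n - 1 - 2 * (i : ℕ)) = 2 * i := by omega
  simp [cSeq, h1, h2]

theorem cSeq_b' {n : ℕ} (i : Fin n) : cSeq n ⟨4 * n - 2 - 2 * i, by omega⟩ = (i, 3) := by
  have h1 : ¬ (4 * n - 2 - 2 * (i : ℕ) < 2 * n) := by omega
  have h2 : 4 * n - 1 - (4 * n - 2 - 2 * (i : ℕ)) = 2 * i + 1 := by omega
  simp [cSeq, h1, h2, Prod.ext_iff, Fin.ext_iff]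
  omega

theorem mem_cEdges_iff {n : ℕ} (hn : 0 < n) (e : Sym2 (Vp n)) : e ∈ cEdges n ↔
    (∃ i : Fin n, e = s((i, 0), (i, 1))) ∨
    (∃ i : Fin n, e = s((i, 2), (i, 3))) ∨
    (∃ i j : Fin n, (i : ℕ) + 1 = (j : ℕ) ∧ (e = s((i, 1), (j, 0)) ∨ e = s((i, 3), (j, 2)))) ∨
    e = s(((⟨0, hn⟩ : Fin n), 0), ((⟨0, hn⟩ : Fin n), 2)) ∨
    e = s(((⟨n - 1, by omega⟩ : Fin n), 1), ((⟨n - 1, by omega⟩ : Fin n), 3)) := by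
  constructor
  · rintro ⟨t, rfl⟩
    have ht := t.isLt
    rcases lt_or_ge t.val (2 * n) with h | h
    · obtain ⟨i, hi⟩ | ⟨i, hi⟩ : (∃ i : Fin n, t.val = 2 * i) ∨ ∃ i : Fin n, t.val = 2 * i + 1 := by
        rcases Nat.even_or_odd' t.val with ⟨c, hc | hc⟩
        · exact Or.inl ⟨⟨c, by omega⟩, hc⟩
        · exact Or.inr ⟨⟨c, by omega⟩, hc⟩
      · left
        refine ⟨i, ?_⟩
        rw [← cSeq_a, ← cSeq_b]
        congr 3
        · exact Fin.ext hi
        · rw [Nat.mod_eq_of_lt (by omega)]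
          omega
      · by_cases hl : (i : ℕ) + 1 < n
        · right; right; left
          refine ⟨i, ⟨i + 1, hl⟩, rfl, Or.inl ?_⟩
          rw [← cSeq_a, ← cSeq_b]
          congr 3
          · exact Fin.ext hi
          · simp only
            rw [Nat.mod_eq_of_lt (by omega)]
            omega
        · right; right; right; right
          rw [← cSeq_b', ← cSeq_b]
          congr 3
          · ext; simp only; omega
          · simp only
            rw [Nat.mod_eq_of_lt (by omega)]
            omega
    · obtain ⟨i, hi⟩ | ⟨i, hi⟩ : (∃ i : Fin n, t.val = 4 * n - 1 - 2 * i) ∨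
          ∃ i : Fin n, t.val = 4 * n - 2 - 2 * i := by
        rcases Nat.even_or_odd' (4 * n - 1 - t.val) with ⟨c, hc | hc⟩
        · exact Or.inl ⟨⟨c, by omega⟩, by simp only; omega⟩
        · exact Or.inr ⟨⟨c, by omega⟩, by simp only; omega⟩
      · by_cases hl : (i : ℕ) = 0
        · right; right; right; left
          rw [← cSeq_a', ← cSeq_a, Sym2.eq_swap]
          congr 3
          · simp only
            rw [show t.val + 1 = 4 * n by omega]
            simp
          · ext; simp only; omega
        · right; right; left
          refine ⟨⟨i - 1, by omega⟩, i, by simp only; omega, Or.inr ?_⟩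
          rw [← cSeq_a', ← cSeq_b', Sym2.eq_swap]
          congr 3
          · simp only
            rw [Nat.mod_eq_of_lt (by omega)]
            omega
          · exact Fin.ext hi
      · right; left
        refine ⟨i, ?_⟩
        rw [← cSeq_a', ← cSeq_b', Sym2.eq_swap]
        congr 3
        · rw [Nat.mod_eq_of_lt (by omega)]
          omega
        · exact Fin.ext hi
  · rintro (⟨i, rfl⟩ | ⟨i, rfl⟩ | ⟨i, j, hij, rfl | rfl⟩ | rfl | rfl)
    · refine ⟨⟨2 * i, by omega⟩, ?_⟩
      rw [← cSeq_a, ← cSeq_b]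
      congr 3
      simp only
      rw [Nat.mod_eq_of_lt (by omega)]
    · refine ⟨⟨4 * n - 2 - 2 * i, by omega⟩, ?_⟩
      rw [← cSeq_a', ← cSeq_b', Sym2.eq_swap]
      congr 3
      simp only
      rw [Nat.mod_eq_of_lt (by omega)]
      omega
    · refine ⟨⟨2 * i + 1, by omega⟩, ?_⟩
      rw [← cSeq_a, ← cSeq_b]
      congr 3
      simp only
      rw [Nat.mod_eq_of_lt (by omega)]
      omega
    · refine ⟨⟨4 * n - 1 - 2 * j, by omega⟩, ?_⟩
      rw [← cSeq_a', ← cSeq_b', Sym2.eq_swap]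
      congr 3
      simp only
      rw [Nat.mod_eq_of_lt (by omega)]
      omega
    · refine ⟨⟨4 * n - 1, by omega⟩, ?_⟩
      rw [← cSeq_a', ← cSeq_a, Sym2.eq_swap]
      congr 3
      simp only
      rw [show 4 * n - 1 + 1 = 4 * n by omega]
      simp
    · refine ⟨⟨2 * n - 1, by omega⟩, ?_⟩
      rw [← cSeq_b, ← cSeq_b']
      congr 3
      · simp only; omega
      · simp only
        rw [Nat.mod_eq_of_lt (by omega)]
        omega

/-- The order in which the positions of a cyclic sequence, cut after the positions
`p₁ < p₂ < p₃ < p₄` into blocks `A, B, C, D, E`, are visited when the blocks are reassembled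
as `A`, `C`, reversed `D`, reversed `B`, `E`. -/
def reassemble (p₁ p₂ p₃ p₄ t : ℕ) : ℕ :=
  if t ≤ p₁ then t
  else if t ≤ p₁ + (p₃ - p₂) then t - p₁ + p₂
  else if t ≤ p₁ + (p₄ - p₂) then p₄ + (p₁ + (p₃ - p₂) + 1) - t
  else if t ≤ p₄ then p₂ + (p₁ + (p₄ - p₂) + 1) - t
  else t

theorem isHamCycleEdgeSet_reassemble {V : Type*} [Fintype V] [DecidableEq V] {m p₁ p₂ p₃ p₄ : ℕ}
    (hcard : Fintype.card V = m) (g : ℕ → V) (hg : ∀ x < m, ∀ y < m, g x = g y → x = y)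
    (h₁₂ : p₁ < p₂) (h₂₃ : p₂ < p₃) (h₃₄ : p₃ + 1 < p₄) (h₄ : p₄ + 1 < m) :
    IsHamCycleEdgeSet (({ e | ∃ t < m, e = s(g t, g ((t + 1) % m)) } \
      {s(g p₁, g (p₁ + 1)), s(g p₂, g (p₂ + 1)), s(g p₃, g (p₃ + 1)), s(g p₄, g (p₄ + 1))}) ∪
      {s(g p₁, g (p₂ + 1)), s(g p₃, g p₄), s(g (p₃ + 1), g p₂), s(g (p₁ + 1), g (p₄ + 1))}) := by
  set R := reassemble p₁ p₂ p₃ p₄ with hR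
  have hA : ∀ t, t ≤ p₁ → R t = t := by
    intro t h
    simp only [hR, reassemble]
    split_ifs; rfl
  have hC : ∀ t, p₁ < t → t ≤ p₁ + (p₃ - p₂) → R t = t - p₁ + p₂ := by
    intro t h h'
    simp only [hR, reassemble]
    split_ifs <;> omega
  have hD : ∀ t, p₁ + (p₃ - p₂) < t → t ≤ p₁ + (p₄ - p₂) →
      R t = p₄ + (p₁ + (p₃ - p₂) + 1) - t := by
    intro t h h'
    simp only [hR, reassemble]
    split_ifs <;> omega
  have hB : ∀ t, p₁ + (p₄ - p₂) < t → t ≤ p₄ → R t = p₂ + (p₁ + (p₄ - p₂) + 1) - t := by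
    intro t h h'
    simp only [hR, reassemble]
    split_ifs <;> omega
  have hE : ∀ t, p₄ < t → R t = t := by
    intro t h
    simp only [hR, reassemble]
    split_ifs <;> omega
  have hlt : ∀ t < m, R t < m := by
    intro t ht
    simp only [hR, reassemble]
    split_ifs <;> omega
  have hbij : Function.Bijective (fun t : Fin m => g (R t)) := by
    rw [Fintype.bijective_iff_injective_and_card]
    refine ⟨fun s t hst => Fin.ext ?_, by simp [hcard]⟩
    have h := hg _ (hlt _ s.isLt) _ (hlt _ t.isLt) hst
    have := s.isLt
    have := t.isLt
    simp only [hR, reassemble] at h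
    split_ifs at h <;> omega
  have hmod : ∀ t, t + 1 < m → (t + 1) % m = t + 1 := fun t => Nat.mod_eq_of_lt
  have hedge : ∀ x < m, ∀ y < m, ∀ u < m, ∀ v < m,
      s(g x, g y) = s(g u, g v) → x = u ∧ y = v ∨ x = v ∧ y = u := by
    intro x hx y hy u hu v hv h
    rcases Sym2.eq_iff.1 h with h | h
    · exact Or.inl ⟨hg _ hx _ hu h.1, hg _ hy _ hv h.2⟩
    · exact Or.inr ⟨hg _ hx _ hv h.1, hg _ hy _ hu h.2⟩
  convert isHamCycleEdgeSet_of_bijective (by omega : 3 ≤ m) _ hbij using 1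
  ext e
  constructor
  · have hmk : ∀ t x y, t + 1 < m → (R t = x ∧ R (t + 1) = y ∨ R t = y ∧ R (t + 1) = x) →
        s(g x, g y) ∈ { e | ∃ t : Fin m, e = s(g (R t), g (R ((t.val + 1) % m))) } := by
      rintro t x y ht (⟨rfl, rfl⟩ | ⟨rfl, rfl⟩)
      · exact ⟨⟨t, by omega⟩, by simp only [hmod t ht]⟩
      · exact ⟨⟨t, by omega⟩, by simp only [hmod t ht]; exact Sym2.eq_swap⟩
    rintro (⟨⟨x, hx, rfl⟩, hne⟩ | rfl | rfl | rfl | rfl)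
    · by_cases hxl : x + 1 = m
      · refine ⟨⟨x, hx⟩, ?_⟩
        have h1 : R x = x := by
          simp only [hR, reassemble]
          split_ifs <;> omega
        have h2 : R 0 = 0 := by simp [hR, reassemble]
        simp [hxl, h1, h2]
      · rw [hmod x (by omega)] at hne ⊢
        have hne₁ : x ≠ p₁ := by rintro rfl; simp at hne
        have hne₂ : x ≠ p₂ := by rintro rfl; simp at hne
        have hne₃ : x ≠ p₃ := by rintro rfl; simp at hne
        have hne₄ : x ≠ p₄ := by rintro rfl; simp at hne
        rcases lt_or_gt_of_ne hne₁ with h | h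
        · exact hmk x _ _ (by omega) (Or.inl
            ⟨(hA _ (by omega)).trans (by omega), (hA _ (by omega)).trans (by omega)⟩)
        rcases lt_or_gt_of_ne hne₂ with h | h
        · exact hmk (p₁ + p₄ - x) _ _ (by omega) (Or.inr
            ⟨(hB _ (by omega) (by omega)).trans (by omega), (hB _ (by omega) (by omega)).trans (by omega)⟩)
        rcases lt_or_gt_of_ne hne₃ with h | h
        · exact hmk (x + p₁ - p₂) _ _ (by omega) (Or.inl
            ⟨(hC _ (by omega) (by omega)).trans (by omega), (hC _ (by omega) (by omega)).trans (by omega)⟩)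
        rcases lt_or_gt_of_ne hne₄ with h | h
        · exact hmk (p₄ + p₁ + p₃ - p₂ - x) _ _ (by omega) (Or.inr
            ⟨(hD _ (by omega) (by omega)).trans (by omega), (hD _ (by omega) (by omega)).trans (by omega)⟩)
        · exact hmk x _ _ (by omega) (Or.inl
            ⟨(hE _ (by omega)).trans (by omega), (hE _ (by omega)).trans (by omega)⟩)
    · exact hmk p₁ _ _ (by omega) (Or.inl
        ⟨(hA _ (by omega)).trans (by omega), (hC _ (by omega) (by omega)).trans (by omega)⟩)
    · exact hmk (p₁ + (p₃ - p₂)) _ _ (by omega) (Or.inl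
        ⟨(hC _ (by omega) (by omega)).trans (by omega), (hD _ (by omega) (by omega)).trans (by omega)⟩)
    · exact hmk (p₁ + (p₄ - p₂)) _ _ (by omega) (Or.inl
        ⟨(hD _ (by omega) (by omega)).trans (by omega), (hB _ (by omega) (by omega)).trans (by omega)⟩)
    · exact hmk p₄ _ _ (by omega) (Or.inl
        ⟨(hB _ (by omega) (by omega)).trans (by omega), (hE _ (by omega)).trans (by omega)⟩)
  · rintro ⟨⟨t, ht⟩, rfl⟩
    have hmk : ∀ x y z, x + 1 < m ∧ x ≠ p₁ ∧ x ≠ p₂ ∧ x ≠ p₃ ∧ x ≠ p₄ →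
        (x = y ∧ x + 1 = z ∨ x = z ∧ x + 1 = y) →
        s(g y, g z) ∈ { e | ∃ t < m, e = s(g t, g ((t + 1) % m)) } \
          {s(g p₁, g (p₁ + 1)), s(g p₂, g (p₂ + 1)), s(g p₃, g (p₃ + 1)),
            s(g p₄, g (p₄ + 1))} := by
      rintro x y z ⟨hx, h1, h2, h3, h4⟩ hyz
      have hs : s(g y, g z) = s(g x, g (x + 1)) := by
        rcases hyz with ⟨rfl, rfl⟩ | ⟨rfl, rfl⟩
        · rfl
        · exact Sym2.eq_swap
      rw [hs]
      refine ⟨⟨x, by omega, by rw [hmod x hx]⟩, ?_⟩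
      rintro (h | h | h | h) <;>
        · have := hedge x (by omega) (x + 1) (by omega) _ (by omega) _ (by omega) h
          omega
    simp only
    by_cases htl : t + 1 = m
    · left
      rw [htl, Nat.mod_self, hE t (by omega), hA 0 (by omega)]
      refine ⟨⟨t, ht, by rw [htl, Nat.mod_self]⟩, ?_⟩
      rintro (h | h | h | h) <;>
        · have := hedge t (by omega) 0 (by omega) _ (by omega) _ (by omega) h
          omega
    rw [hmod t (by omega)]
    rcases lt_trichotomy t p₁ with h | h | h
    · exact Or.inl (hmk t _ _ (by omega)
        (Or.inl ⟨by rw [hA _ (by omega)],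
          by rw [hA _ (by omega)]⟩))
    · right; left
      rw [show R t = p₁ from (hA _ (by omega)).trans (by omega),
        show R (t + 1) = p₂ + 1 from (hC _ (by omega) (by omega)).trans (by omega)]
    rcases lt_trichotomy t (p₁ + (p₃ - p₂)) with h | h | h
    · exact Or.inl (hmk (t - p₁ + p₂) _ _ (by omega)
        (Or.inl ⟨by rw [hC _ (by omega) (by omega)],
          by rw [hC _ (by omega) (by omega)]; omega⟩))
    · right; right; left
      rw [show R t = p₃ from (hC _ (by omega) (by omega)).trans (by omega),
        show R (t + 1) = p₄ from (hD _ (by omega) (by omega)).trans (by omega)]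
    rcases lt_trichotomy t (p₁ + (p₄ - p₂)) with h | h | h
    · exact Or.inl (hmk (p₄ + (p₁ + (p₃ - p₂)) - t) _ _ (by omega)
        (Or.inr ⟨by rw [hD _ (by omega) (by omega)]; omega,
          by rw [hD _ (by omega) (by omega)]; omega⟩))
    · right; right; right; left
      rw [show R t = p₃ + 1 from (hD _ (by omega) (by omega)).trans (by omega),
        show R (t + 1) = p₂ from (hB _ (by omega) (by omega)).trans (by omega)]
    rcases lt_trichotomy t p₄ with h | h | h
    · exact Or.inl (hmk (p₂ + (p₁ + (p₄ - p₂)) - t) _ _ (by omega)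
        (Or.inr ⟨by rw [hB _ (by omega) (by omega)]; omega,
          by rw [hB _ (by omega) (by omega)]; omega⟩))
    · right; right; right; right
      rw [show R t = p₁ + 1 from (hB _ (by omega) (by omega)).trans (by omega),
        show R (t + 1) = p₄ + 1 from (hE _ (by omega)).trans (by omega)]
      rfl
    · exact Or.inl (hmk t _ _ (by omega)
        (Or.inl ⟨by rw [hE _ (by omega)],
          by rw [hE _ (by omega)]⟩))

/-- The edge sets `Dm` and `Dp` are the removed and the added edges of an exchange which only
removes edges `a_i b_i` and `a_i' b_i'`, only adds edges of weight less than `M₂` outside `C`, and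
keeps the degree of every vertex. -/
structure IsLightExchange (n : ℕ) (Dm Dp : Set (Sym2 (Vp n))) : Prop where
  removed : ∀ e ∈ Dm, (∃ i : Fin n, e = s((i, 0), (i, 1))) ∨ ∃ i : Fin n, e = s((i, 2), (i, 3))
  added : ∀ e ∈ Dp, (∃ i : Fin n, e = s((i, 0), (i, 3))) ∨
    (∃ i j : Fin n, i < j ∧ e = s((i, 0), (j, 1))) ∨
    ∃ i j : Fin n, j < i ∧ e = s((i, 2), (j, 1))
  degree : ∀ v, {u | s(v, u) ∈ Dp}.ncard = {u | s(v, u) ∈ Dm}.ncard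

namespace IsLightExchange

variable {n : ℕ} {Dm Dp : Set (Sym2 (Vp n))}

theorem removed_unique (h : IsLightExchange n Dm Dp) {v u u' : Vp n} (hu : s(v, u) ∈ Dm)
    (hu' : s(v, u') ∈ Dm) : u = u' := by
  rcases h.removed _ hu with ⟨i, hi⟩ | ⟨i, hi⟩ <;> rcases h.removed _ hu' with ⟨j, hj⟩ | ⟨j, hj⟩ <;>
    rcases Sym2.eq_iff.1 hi with ⟨rfl, rfl⟩ | ⟨rfl, rfl⟩ <;>
    simp [Prod.ext_iff] at hj ⊢ <;> grind

theorem exists_added (h : IsLightExchange n Dm Dp) {v u : Vp n} (hu : s(v, u) ∈ Dm) :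
    ∃ x, {y | s(v, y) ∈ Dp} = {x} := by
  rw [← Set.ncard_eq_one, h.degree, Set.ncard_eq_one]
  exact ⟨u, Set.eq_singleton_iff_unique_mem.2 ⟨hu, fun y hy => h.removed_unique hy hu⟩⟩

theorem added_unique (h : IsLightExchange n Dm Dp) {v u x y : Vp n} (hu : s(v, u) ∈ Dm)
    (hx : s(v, x) ∈ Dp) (hy : s(v, y) ∈ Dp) : x = y := by
  obtain ⟨z, hz⟩ := h.exists_added hu
  have hx' : x ∈ {y | s(v, y) ∈ Dp} := hx
  have hy' : y ∈ {y | s(v, y) ∈ Dp} := hy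
  rw [hz] at hx' hy'
  exact hx'.trans hy'.symm

theorem exists_removed (h : IsLightExchange n Dm Dp) {v u : Vp n} (hu : s(v, u) ∈ Dp) :
    ∃ x, s(v, x) ∈ Dm := by
  have : {u | s(v, u) ∈ Dm}.ncard ≠ 0 := by
    rw [← h.degree]
    exact Set.ncard_ne_zero_of_mem (a := u) hu
  exact Set.nonempty_of_ncard_ne_zero this

theorem removed_of_b (h : IsLightExchange n Dm Dp) {u : Vp n} {i : Fin n}
    (hu : s(u, (i, 1)) ∈ Dp) : s((i, 0), (i, 1)) ∈ Dm := by
  rw [Sym2.eq_swap] at hu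
  obtain ⟨x, hx⟩ := h.exists_removed hu
  have := hx
  rcases h.removed _ hx with ⟨j, hj⟩ | ⟨j, hj⟩ <;> simp [Prod.ext_iff] at hj
  rw [Sym2.eq_swap]
  convert hx using 2
  simp [Prod.ext_iff, hj]

theorem removed_of_a (h : IsLightExchange n Dm Dp) {u : Vp n} {i : Fin n}
    (hu : s((i, 0), u) ∈ Dp) : s((i, 0), (i, 1)) ∈ Dm := by
  obtain ⟨x, hx⟩ := h.exists_removed hu
  rcases h.removed _ hx with ⟨j, hj⟩ | ⟨j, hj⟩ <;> simp [Prod.ext_iff] at hj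
  convert hx using 2
  simp [Prod.ext_iff, hj]

theorem removed_of_a' (h : IsLightExchange n Dm Dp) {u : Vp n} {i : Fin n}
    (hu : s((i, 2), u) ∈ Dp) : s((i, 2), (i, 3)) ∈ Dm := by
  obtain ⟨x, hx⟩ := h.exists_removed hu
  rcases h.removed _ hx with ⟨j, hj⟩ | ⟨j, hj⟩ <;> simp [Prod.ext_iff] at hj
  convert hx using 2
  simp [Prod.ext_iff, hj]

theorem removed_of_b' (h : IsLightExchange n Dm Dp) {u : Vp n} {i : Fin n}
    (hu : s(u, (i, 3)) ∈ Dp) : s((i, 2), (i, 3)) ∈ Dm := by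
  rw [Sym2.eq_swap] at hu
  obtain ⟨x, hx⟩ := h.exists_removed hu
  rcases h.removed _ hx with ⟨j, hj⟩ | ⟨j, hj⟩ <;> simp [Prod.ext_iff] at hj
  rw [Sym2.eq_swap]
  convert hx using 2
  simp [Prod.ext_iff, hj]

theorem added_at_a (h : IsLightExchange n Dm Dp) {i : Fin n} (hi : s((i, 0), (i, 1)) ∈ Dm) :
    s((i, 0), (i, 3)) ∈ Dp ∨ ∃ j, i < j ∧ s((i, 0), (j, 1)) ∈ Dp := by
  obtain ⟨x, hx⟩ := h.exists_added hi
  have hx : s((i, 0), x) ∈ Dp := by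
    change x ∈ {y | s((i, 0), y) ∈ Dp}
    simp [hx]
  rcases h.added _ hx with ⟨j, hj⟩ | ⟨j, k, hjk, hj⟩ | ⟨j, k, hjk, hj⟩ <;>
    simp [Prod.ext_iff] at hj
  · left
    convert hx using 2
    simp [Prod.ext_iff, hj]
  · right
    refine ⟨k, hj.1 ▸ hjk, ?_⟩
    convert hx using 2
    simp [Prod.ext_iff, hj]

theorem added_at_b (h : IsLightExchange n Dm Dp) {j : Fin n} (hj : s((j, 0), (j, 1)) ∈ Dm) :
    (∃ i, i < j ∧ s((i, 0), (j, 1)) ∈ Dp) ∨ ∃ i, j < i ∧ s((i, 2), (j, 1)) ∈ Dp := by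
  rw [Sym2.eq_swap] at hj
  obtain ⟨x, hx⟩ := h.exists_added hj
  have hx : s((j, 1), x) ∈ Dp := by
    change x ∈ {y | s((j, 1), y) ∈ Dp}
    simp [hx]
  rcases h.added _ hx with ⟨i, hi⟩ | ⟨i, k, hik, hi⟩ | ⟨i, k, hik, hi⟩ <;>
    simp [Prod.ext_iff] at hi
  · left
    refine ⟨i, hi.1 ▸ hik, ?_⟩
    rw [Sym2.eq_swap]
    convert hx using 2
    simp [Prod.ext_iff, hi]
  · right
    refine ⟨i, hi.1 ▸ hik, ?_⟩
    rw [Sym2.eq_swap]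
    convert hx using 2
    simp [Prod.ext_iff, hi]

theorem last_added (h : IsLightExchange n Dm Dp) {k : Fin n} (hk : s((k, 0), (k, 1)) ∈ Dm)
    (hmax : ∀ i, s((i, 0), (i, 1)) ∈ Dm → i ≤ k) : s((k, 0), (k, 3)) ∈ Dp := by
  rcases h.added_at_a hk with h' | ⟨j, hkj, hj⟩
  · exact h'
  · exact absurd (hmax _ (h.removed_of_b hj)) (not_le.2 hkj)

theorem removed_eq_empty (h : IsLightExchange n Dm Dp)
    (hQ : ∀ i : Fin n, s((i, 2), (i, 3)) ∉ Dm) : Dm = ∅ := by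
  classical
  let P : Finset (Fin n) := {i | s((i, 0), (i, 1)) ∈ Dm}
  have hP : P = ∅ := by
    by_contra hne
    have hne := Finset.nonempty_iff_ne_empty.2 hne
    have hk : s((P.max' hne, 0), (P.max' hne, 1)) ∈ Dm := by
      simpa [P] using P.max'_mem hne
    exact hQ _ (h.removed_of_b' (h.last_added hk fun i hi => P.le_max' i (by simpa [P] using hi)))
  refine Set.eq_empty_iff_forall_notMem.2 fun e he => ?_
  rcases h.removed e he with ⟨i, rfl⟩ | ⟨i, rfl⟩
  · have : i ∈ P := by simpa [P] using he
    simp [hP] at this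
  · exact hQ i he

theorem added_eq_empty (h : IsLightExchange n Dm Dp) (hDm : Dm = ∅) : Dp = ∅ := by
  refine Set.eq_empty_iff_forall_notMem.2 fun e => ?_
  induction e with
  | _ v u =>
    intro he
    obtain ⟨x, hx⟩ := h.exists_removed he
    simp [hDm] at hx

theorem exists_triangle (h : IsLightExchange n Dm Dp) {i j k l : Fin n} (hij : i < j) (hjk : j < k)
    (hP : ∀ m, s((m, 0), (m, 1)) ∈ Dm ↔ m = i ∨ m = j ∨ m = k)
    (hQ : ∀ m, s((m, 2), (m, 3)) ∈ Dm ↔ m = l) :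
    s((k, 0), (k, 3)) ∈ Dp ∧ s((k, 2), (i, 1)) ∈ Dp ∧ s((i, 0), (j, 1)) ∈ Dp ∧
      s((j, 0), (k, 1)) ∈ Dp := by
  have hi := (hP i).2 (by simp)
  have hj := (hP j).2 (by simp)
  have hk := (hP k).2 (by simp)
  have hk3 : s((k, 0), (k, 3)) ∈ Dp := by
    refine h.last_added hk fun m hm => ?_
    rcases (hP m).1 hm with rfl | rfl | rfl
    exacts [(hij.trans hjk).le, hjk.le, le_rfl]
  obtain rfl : k = l := (hQ k).1 (h.removed_of_b' hk3)
  have hk2 := (hQ k).2 rfl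
  have hki : s((k, 2), (i, 1)) ∈ Dp := by
    rcases h.added_at_b hi with ⟨m, hm, hm'⟩ | ⟨m, hm, hm'⟩
    · rcases (hP m).1 (h.removed_of_a hm') with rfl | rfl | rfl <;> omega
    · obtain rfl := (hQ m).1 (h.removed_of_a' hm')
      exact hm'
  have hij' : s((i, 0), (j, 1)) ∈ Dp := by
    rcases h.added_at_b hj with ⟨m, hm, hm'⟩ | ⟨m, hm, hm'⟩
    · rcases (hP m).1 (h.removed_of_a hm') with rfl | rfl | rfl
      · exact hm'
      · omega
      · omega
    · obtain rfl := (hQ m).1 (h.removed_of_a' hm')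
      have := h.added_unique hk2 hki hm'
      simp [Prod.ext_iff] at this
      omega
  refine ⟨hk3, hki, hij', ?_⟩
  rcases h.added_at_b hk with ⟨m, hm, hm'⟩ | ⟨m, hm, hm'⟩
  · rcases (hP m).1 (h.removed_of_a hm') with rfl | rfl | rfl
    · have := h.added_unique hi hij' hm'
      simp [Prod.ext_iff] at this
      omega
    · exact hm'
    · omega
  · obtain rfl := (hQ m).1 (h.removed_of_a' hm')
    omega

end IsLightExchange

theorem isHamCycleEdgeSet_cEdges {n : ℕ} (hn : 0 < n) : IsHamCycleEdgeSet (cEdges n) :=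
  isHamCycleEdgeSet_of_bijective (by omega) (cSeq n) (cSeq_bijective n)

theorem finsum_mem_lt_iff_sdiff {α : Type*} [Finite α] (S T : Set α) (f : α → ℤ) :
    ∑ᶠ e ∈ T, f e < ∑ᶠ e ∈ S, f e ↔ ∑ᶠ e ∈ T \ S, f e < ∑ᶠ e ∈ S \ T, f e := by
  rw [← finsum_mem_inter_add_sdiff S (Set.toFinite T),
    ← finsum_mem_inter_add_sdiff T (Set.toFinite S), Set.inter_comm S T]
  exact add_lt_add_iff_left _

theorem neg_mul_le_sum {α : Type*} (s : Finset α) (f : α → ℤ) {c : ℤ} {N : ℕ} (hc : 0 ≤ c)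
    (hs : s.card ≤ N) (hf : ∀ x ∈ s, -c ≤ f x) : -(N * c) ≤ ∑ x ∈ s, f x := by
  have h := Finset.card_nsmul_le_sum s f (-c) hf
  have h' : (s.card : ℤ) * c ≤ N * c := by gcongr
  simp only [nsmul_eq_mul] at h
  linarith

theorem add_neg_mul_le_sum {α : Type*} (s : Finset α) (f : α → ℤ) {c : ℤ} {N : ℕ} (hc : 0 ≤ c)
    (hs : s.card ≤ N + 1) (hf : ∀ x ∈ s, -c ≤ f x) {x₀ : α} (hx₀ : x₀ ∈ s) :
    f x₀ - N * c ≤ ∑ x ∈ s, f x := by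
  classical
  rw [← Finset.add_sum_erase s f hx₀]
  have := neg_mul_le_sum (s.erase x₀) f (N := N) hc (by rw [Finset.card_erase_of_mem hx₀]; omega)
    fun x hx => hf x (Finset.mem_of_mem_erase hx)
  linarith

theorem exists_improving_of_triangle {n : ℕ} {hn : 0 < n} {w : Sym2 (Fin n) → ℤ} {W : ℤ}
    {w' : Sym2 (Vp n) → ℤ} (hw' : IsReductionWeight n hn w W w') {i j k : Fin n} (hij : i < j)
    (hjk : j < k) (hneg : w s(i, j) + w s(j, k) + w s(i, k) < 0) :
    ∃ Em Ep : Set (Sym2 (Vp n)), IsImproving4Move n w' Em Ep := by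
  obtain ⟨haa, hab, hab', hM, hM', -⟩ := hw'
  have hik := hij.trans hjk
  let Fm : Finset (Sym2 (Vp n)) :=
    {s((i, 0), (i, 1)), s((j, 0), (j, 1)), s((k, 0), (k, 1)), s((k, 3), (k, 2))}
  let Fp : Finset (Sym2 (Vp n)) :=
    {s((i, 0), (j, 1)), s((k, 0), (k, 3)), s((k, 1), (j, 0)), s((i, 1), (k, 2))}
  have hFm : Fm.card = 4 := by
    simp [Fm, Finset.card_insert_of_notMem, Prod.ext_iff, hij.ne, hjk.ne, hik.ne]
  have hFp : Fp.card = 4 := by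
    simp [Fp, Finset.card_insert_of_notMem, Prod.ext_iff, hij.ne, hjk.ne, hik.ne]
  have hmC : (Fm : Set (Sym2 (Vp n))) ⊆ cEdges n := by
    intro e he
    rw [mem_cEdges_iff hn]
    simp only [Fm, Finset.coe_insert, Finset.coe_singleton, Set.mem_insert_iff,
      Set.mem_singleton_iff] at he
    rcases he with rfl | rfl | rfl | rfl
    · exact Or.inl ⟨i, rfl⟩
    · exact Or.inl ⟨j, rfl⟩
    · exact Or.inl ⟨k, rfl⟩
    · exact Or.inr (Or.inl ⟨k, Sym2.eq_swap⟩)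
  have hpC : ∀ e ∈ Fp, e ∉ cEdges n := by
    intro e he
    rw [mem_cEdges_iff hn]
    simp only [Fp, Finset.mem_insert, Finset.mem_singleton] at he
    rcases he with rfl | rfl | rfl | rfl <;> simp [Prod.ext_iff] <;> grind
  refine ⟨Fm, Fp, ?_, ?_, hmC, ?_, ?_, ?_⟩
  · rw [Set.ncard_coe_finset, hFm]
  · rw [Set.ncard_coe_finset, hFp]
  · intro e he
    simp only [Fp, Finset.coe_insert, Finset.coe_singleton, Set.mem_insert_iff,
      Set.mem_singleton_iff] at he
    rcases he with rfl | rfl | rfl | rfl <;> simp [Prod.ext_iff]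
  · let g : ℕ → Vp n := fun t => cSeq n ⟨t % (4 * n), Nat.mod_lt _ (by omega)⟩
    have hgt : ∀ t (ht : t < 4 * n), g t = cSeq n ⟨t, ht⟩ := by
      intro t ht
      simp only [g, Nat.mod_eq_of_lt ht]
    have hg : ∀ x < 4 * n, ∀ y < 4 * n, g x = g y → x = y := by
      intro x hx y hy hxy
      rw [hgt x hx, hgt y hy] at hxy
      simpa using (cSeq_bijective n).injective hxy
    have hij' : (i : ℕ) < j := hij
    have hjk' : (j : ℕ) < k := hjk
    have hk := k.isLt
    have hham := isHamCycleEdgeSet_reassemble (by simp [mul_comm]) g hg (p₁ := 2 * i)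
      (p₂ := 2 * j) (p₃ := 2 * k) (p₄ := 4 * n - 2 - 2 * k) (by omega) (by omega) (by omega)
      (by omega)
    have ha : ∀ i : Fin n, g (2 * i) = (i, 0) := fun i => by rw [hgt _ (by omega), cSeq_a]
    have hb : ∀ i : Fin n, g (2 * i + 1) = (i, 1) := fun i => by rw [hgt _ (by omega), cSeq_b]
    have hb' : ∀ i : Fin n, g (4 * n - 2 - 2 * i) = (i, 3) := fun i => by
      rw [hgt _ (by omega), cSeq_b']
    have ha' : ∀ i : Fin n, g (4 * n - 2 - 2 * i + 1) = (i, 2) := fun i => by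
      rw [← cSeq_a', hgt _ (by omega)]
      congr 2
      omega
    have hC : { e | ∃ t < 4 * n, e = s(g t, g ((t + 1) % (4 * n))) } = cEdges n := by
      ext e
      constructor
      · rintro ⟨t, ht, rfl⟩
        refine ⟨⟨t, ht⟩, ?_⟩
        rw [hgt t ht, hgt _ (Nat.mod_lt _ (by omega))]
      · rintro ⟨⟨t, ht⟩, rfl⟩
        refine ⟨t, ht, ?_⟩
        rw [hgt t ht, hgt _ (Nat.mod_lt _ (by omega))]
    simpa only [hC, ha, hb, ha', hb', Fm, Fp, Finset.coe_insert, Finset.coe_singleton] using hham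
  · rw [finsum_mem_lt_iff_sdiff]
    have hT : ((cEdges n \ Fm) ∪ Fp) \ cEdges n = (Fp : Set (Sym2 (Vp n))) := by
      ext e
      have := hpC e
      simp only [Set.mem_sdiff, Set.mem_union, Finset.mem_coe]
      tauto
    have hS : cEdges n \ ((cEdges n \ Fm) ∪ Fp) = (Fm : Set (Sym2 (Vp n))) := by
      ext e
      have := hpC e
      have := @hmC e
      simp only [Set.mem_sdiff, Set.mem_union, Finset.mem_coe] at *
      tauto
    rw [hT, hS, finsum_mem_coe_finset, finsum_mem_coe_finset]
    have hsp : ∑ e ∈ Fp, w' e = w s(i, j) + (0 + (w s(j, k) + w s(i, k))) := by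
      rw [Finset.sum_insert (by simp [Prod.ext_iff, hij.ne, hjk.ne, hik.ne]),
        Finset.sum_insert (by simp [Prod.ext_iff]),
        Finset.sum_insert (by simp [Prod.ext_iff]), Finset.sum_singleton,
        hab _ _ hij, haa, Sym2.eq_swap (a := ((k, 1) : Vp n)), hab _ _ hjk,
        Sym2.eq_swap (a := ((i, 1) : Vp n)), hab' _ _ hik, Sym2.eq_swap (a := k)]
    have hsm : ∑ e ∈ Fm, w' e = M1 W + (M1 W + (M1 W + -3 * M1 W)) := by
      rw [Finset.sum_insert (by simp [Prod.ext_iff, hij.ne, hik.ne]),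
        Finset.sum_insert (by simp [Prod.ext_iff, hjk.ne]),
        Finset.sum_insert (by simp [Prod.ext_iff]), Finset.sum_singleton,
        hM, hM, hM, Sym2.eq_swap, hM']
    rw [hsp, hsm]
    linarith

theorem triangle_of_improving {n : ℕ} {hn : 0 < n} {w : Sym2 (Fin n) → ℤ} {W : ℤ}
    (hW₀ : 0 ≤ W) (hW : ∀ i j : Fin n, i ≠ j → |w s(i, j)| ≤ W)
    {w' : Sym2 (Vp n) → ℤ} (hw' : IsReductionWeight n hn w W w') {Em Ep : Set (Sym2 (Vp n))}
    (hmove : IsImproving4Move n w' Em Ep) :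
    ∃ i j k : Fin n, i < j ∧ j < k ∧ w s(i, j) + w s(j, k) + w s(i, k) < 0 := by
  classical
  obtain ⟨haa, hab, hab', hM, hM', hMM, hMM0, hMMn, hrest⟩ := hw'
  obtain ⟨hEm, hEp, -, -, hham, hlt⟩ := hmove
  rw [finsum_mem_lt_iff_sdiff] at hlt
  set T := (cEdges n \ Em) ∪ Ep with hT
  have hdegree : ∀ v, {u | s(v, u) ∈ T \ cEdges n}.ncard = {u | s(v, u) ∈ cEdges n \ T}.ncard := by
    intro v
    have h₁ := hham.ncard_neighbors v
    have h₂ := (isHamCycleEdgeSet_cEdges hn).ncard_neighbors v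
    have h₃ := Set.ncard_inter_add_ncard_sdiff_eq_ncard {u | s(v, u) ∈ T} {u | s(v, u) ∈ cEdges n}
    have h₄ := Set.ncard_inter_add_ncard_sdiff_eq_ncard {u | s(v, u) ∈ cEdges n} {u | s(v, u) ∈ T}
    rw [Set.inter_comm] at h₄
    change ({u | s(v, u) ∈ T} \ {u | s(v, u) ∈ cEdges n}).ncard =
      ({u | s(v, u) ∈ cEdges n} \ {u | s(v, u) ∈ T}).ncard
    omega
  have hM1 : M1 W = 5 * W + 1 := rfl
  have hM2 : M2 W = 21 * M1 W + 1 := rfl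
  obtain ⟨Dp, hDp⟩ := (Set.toFinite (T \ cEdges n)).exists_finset_coe
  obtain ⟨Dm, hDm⟩ := (Set.toFinite (cEdges n \ T)).exists_finset_coe
  rw [← hDp, ← hDm, finsum_mem_coe_finset, finsum_mem_coe_finset] at hlt
  have hcDp : Dp.card ≤ 4 := by
    rw [← hEp, ← Set.ncard_coe_finset, hDp]
    refine Set.ncard_le_ncard (fun e he => ?_) (Set.toFinite _)
    exact he.1.resolve_left fun h => he.2 h.1
  have hcDm : Dm.card ≤ 4 := by
    rw [← hEm, ← Set.ncard_coe_finset, hDm]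
    refine Set.ncard_le_ncard (fun e he => ?_) (Set.toFinite _)
    by_contra h
    exact he.2 (Or.inl ⟨he.1, h⟩)
  have hmemp : ∀ e, e ∈ Dp ↔ e ∈ T \ cEdges n := fun e => by rw [← hDp, Finset.mem_coe]
  have hmemm : ∀ e, e ∈ Dm ↔ e ∈ cEdges n \ T := fun e => by rw [← hDm, Finset.mem_coe]
  have hwp : ∀ e ∈ Dp, w' e = M2 W ∨ ((∃ i : Fin n, e = s((i, 0), (i, 3))) ∨
      (∃ i j : Fin n, i < j ∧ e = s((i, 0), (j, 1))) ∨
      ∃ i j : Fin n, j < i ∧ e = s((i, 2), (j, 1))) := by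
    intro e he
    have heC := ((hmemp e).1 he).2
    rw [mem_cEdges_iff hn] at heC
    by_cases hs : SpecialPair n hn e
    · rcases hs with h | h | h | hs
      · exact Or.inr (Or.inl h)
      · exact Or.inr (Or.inr (Or.inl h))
      · exact Or.inr (Or.inr (Or.inr h))
      · exact absurd hs heC
    · exact Or.inl (hrest e hs)
  have hwm : ∀ e ∈ Dm, w' e = -M2 W ∨ ((∃ i : Fin n, e = s((i, 0), (i, 1))) ∨
      ∃ i : Fin n, e = s((i, 2), (i, 3))) := by
    intro e he
    have heC := ((hmemm e).1 he).1
    rw [mem_cEdges_iff hn] at heC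
    rcases heC with h | h | ⟨i, j, h, rfl | rfl⟩ | rfl | rfl
    · exact Or.inr (Or.inl h)
    · exact Or.inr (Or.inr h)
    · exact Or.inl (hMM i j h).1
    · exact Or.inl (hMM i j h).2
    · exact Or.inl hMM0
    · exact Or.inl hMMn
  have hlow : ∀ e ∈ Dp, -W ≤ w' e := by
    intro e he
    rcases hwp e he with h | ⟨i, rfl⟩ | ⟨i, j, hij, rfl⟩ | ⟨i, j, hij, rfl⟩
    · rw [h]; linarith
    · rw [haa]; linarith
    · rw [hab _ _ hij]; exact (abs_le.1 (hW _ _ hij.ne)).1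
    · rw [hab' _ _ hij]; exact (abs_le.1 (hW _ _ hij.ne')).1
  have hupp : ∀ e ∈ Dm, -M1 W ≤ -w' e := by
    intro e he
    rcases hwm e he with h | ⟨i, rfl⟩ | ⟨i, rfl⟩
    · rw [h]; linarith
    · rw [hM]
    · rw [hM']; linarith
  have hsp := neg_mul_le_sum Dp w' (N := 4) hW₀ hcDp hlow
  have hsm := neg_mul_le_sum Dm (fun e => -w' e) (N := 4) (by linarith) hcDm hupp
  simp only [Finset.sum_neg_distrib] at hsm
  push_cast at hsp hsm
  have hlight : IsLightExchange n (Dm : Set (Sym2 (Vp n))) Dp := by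
    refine ⟨fun e he => ?_, fun e he => ?_, by rw [hDp, hDm]; exact hdegree⟩
    · refine (hwm e he).resolve_left fun h => ?_
      have := add_neg_mul_le_sum Dm (fun e => -w' e) (N := 3) (by linarith) hcDm hupp he
      simp only [Finset.sum_neg_distrib, h] at this
      push_cast at this
      linarith
    · refine (hwp e he).resolve_left fun h => ?_
      have := add_neg_mul_le_sum Dp w' (N := 3) hW₀ hcDp hlow he
      rw [h] at this
      push_cast at this
      linarith
  let P : Finset (Fin n) := {i | s((i, 0), (i, 1)) ∈ Dm}
  let Q : Finset (Fin n) := {i | s((i, 2), (i, 3)) ∈ Dm}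
  have hmemP : ∀ i, s((i, 0), (i, 1)) ∈ Dm ↔ i ∈ P := by simp [P]
  have hmemQ : ∀ i, s((i, 2), (i, 3)) ∈ Dm ↔ i ∈ Q := by simp [Q]
  let ea : Fin n → Sym2 (Vp n) := fun i => s((i, 0), (i, 1))
  let eb : Fin n → Sym2 (Vp n) := fun i => s((i, 2), (i, 3))
  have hea : Function.Injective ea := fun i j h => by simpa [ea] using h
  have heb : Function.Injective eb := fun i j h => by simpa [eb] using h
  have hDmPQ : Dm = P.image ea ∪ Q.image eb := by
    ext e
    simp only [Finset.mem_union, Finset.mem_image]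
    constructor
    · intro he
      rcases hlight.removed e he with ⟨i, rfl⟩ | ⟨i, rfl⟩
      · exact Or.inl ⟨i, (hmemP i).1 he, rfl⟩
      · exact Or.inr ⟨i, (hmemQ i).1 he, rfl⟩
    · rintro (⟨i, hi, rfl⟩ | ⟨i, hi, rfl⟩)
      · exact (hmemP i).2 hi
      · exact (hmemQ i).2 hi
  have hdisj : Disjoint (P.image ea) (Q.image eb) := by
    rw [Finset.disjoint_left]
    intro e h₁ h₂
    obtain ⟨i, -, rfl⟩ := Finset.mem_image.1 h₁
    obtain ⟨j, -, h⟩ := Finset.mem_image.1 h₂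
    simp [ea, eb] at h
  have hcard : P.card + Q.card ≤ 4 := by
    rw [hDmPQ, Finset.card_union_of_disjoint hdisj, Finset.card_image_of_injective _ hea,
      Finset.card_image_of_injective _ heb] at hcDm
    exact hcDm
  have hsum : ∑ e ∈ Dm, w' e = P.card * M1 W - 3 * (Q.card * M1 W) := by
    rw [hDmPQ, Finset.sum_union hdisj, Finset.sum_image hea.injOn, Finset.sum_image heb.injOn]
    simp only [ea, eb, hM, hM', Finset.sum_const, nsmul_eq_mul]
    ring
  have hQ : Q.card ≠ 0 := by
    intro h
    have hDm0 := hlight.removed_eq_empty fun i hi => by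
      have := (hmemQ i).1 hi
      simp [Finset.card_eq_zero.1 h] at this
    have hDp0 := hlight.added_eq_empty hDm0
    rw [Finset.coe_eq_empty] at hDm0 hDp0
    simp [hDm0, hDp0] at hlt
  have hPQ : P.card = 3 ∧ Q.card = 1 := by
    rw [hsum] at hlt
    have h : (3 * Q.card : ℤ) ≤ P.card := by
      by_contra h
      have : ((P.card : ℤ) + 1) * M1 W ≤ (3 * Q.card) * M1 W := by
        gcongr
        · linarith
        · omega
      linarith
    omega
  have ⟨i, j, k, hij, hjk, hPijk⟩ : ∃ i j k, i < j ∧ j < k ∧ P = {i, j, k} := by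
    let o := P.orderEmbOfFin hPQ.1
    refine ⟨o 0, o 1, o 2, o.strictMono (by decide), o.strictMono (by decide), ?_⟩
    refine (Finset.image_orderEmbOfFin_univ P hPQ.1).symm.trans ?_
    rw [show (Finset.univ : Finset (Fin 3)) = {0, 1, 2} from rfl, Finset.image_insert,
      Finset.image_insert, Finset.image_singleton]
  obtain ⟨l, hl⟩ := Finset.card_eq_one.1 hPQ.2
  obtain ⟨h₁, h₂, h₃, h₄⟩ := hlight.exists_triangle hij hjk (l := l)
    (fun m => by rw [Finset.mem_coe, hmemP, hPijk]; simp)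
    (fun m => by rw [Finset.mem_coe, hmemQ, hl]; simp)
  refine ⟨i, j, k, hij, hjk, ?_⟩
  have hik := hij.trans hjk
  let Fp : Finset (Sym2 (Vp n)) :=
    {s((k, 0), (k, 3)), s((k, 2), (i, 1)), s((i, 0), (j, 1)), s((j, 0), (k, 1))}
  have hFp : Fp = Dp := by
    refine Finset.eq_of_subset_of_card_le ?_ ?_
    · simp only [Fp, Finset.insert_subset_iff, Finset.singleton_subset_iff]
      exact ⟨h₁, h₂, h₃, h₄⟩
    · have : Fp.card = 4 := by
        simp [Fp, Finset.card_insert_of_notMem, Prod.ext_iff, hij.ne, hjk.ne, hik.ne]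
      omega
  have hsFp : ∑ e ∈ Fp, w' e = 0 + (w s(i, k) + (w s(i, j) + w s(j, k))) := by
    rw [Finset.sum_insert (by simp [Prod.ext_iff]),
      Finset.sum_insert (by simp [Prod.ext_iff]),
      Finset.sum_insert (by simp [Prod.ext_iff, hij.ne]), Finset.sum_singleton,
      haa, hab' _ _ hik, hab _ _ hij, hab _ _ hjk, Sym2.eq_swap (a := k)]
  rw [← hFp, hsFp, hsum, hPQ.1, hPQ.2] at hlt
  push_cast at hlt
  linarith

/-- `G` contains a negative triangle iff there is an improving
`4`-move for the Hamiltonian cycle `C` in the constructed instance `(G', w')`. -/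
theorem stmt_11 (n : ℕ) (hn : 0 < n) (w : Sym2 (Fin n) → ℤ) (W : ℤ)
    (hW : IsGreatest { x : ℤ | ∃ u v : Fin n, u ≠ v ∧ x = |w s(u, v)| } W)
    (w' : Sym2 (Vp n) → ℤ) (hw' : IsReductionWeight n hn w W w') :
    (∃ i j k : Fin n, i < j ∧ j < k ∧ w s(i, j) + w s(j, k) + w s(i, k) < 0) ↔
      ∃ Em Ep : Set (Sym2 (Vp n)), IsImproving4Move n w' Em Ep := by
  have hbound : ∀ i j : Fin n, i ≠ j → |w s(i, j)| ≤ W := fun i j h => hW.2 ⟨i, j, h, rfl⟩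
  have hW₀ : 0 ≤ W := by
    obtain ⟨u, v, -, h⟩ := hW.1
    exact h ▸ abs_nonneg _
  constructor
  · rintro ⟨i, j, k, hij, hjk, h⟩
    exact exists_improving_of_triangle hw' hij hjk h
  · rintro ⟨Em, Ep, h⟩
    exact triangle_of_improving hW₀ hbound hw' h
end

section
/- Let (G, w) be a complete graph on vertices v_1,…,v_n with integer edge weights and let (G', w', C) be the instance constructed from it as described. If 1 ≤ i < j < k ≤ n and w(v_i,v_j) + w(v_j,v_k) + w(v_k,v_i) < 0, then removing the edges (a_i, b_i), (a_j, b_j), (a_k, b_k), (a_k', b_k') from C and inserting the edges (a_i, b_j), (a_j, b_k), (a_k, b_k'), (a_k', b_i) yields a Hamiltonian cycle of G', and its total w'-weight is strictly smaller than that of C (the removed edges have total weight 0 and the inserted edges have total weight w(v_i,v_j) + w(v_j,v_k) + w(v_k,v_i) < 0). -/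
/-- A set of edges consisting of the pairs of cyclically consecutive vertices with respect to a
numbering of the vertices by `Fin N`, `3 ≤ N`, is the edge set of a Hamiltonian cycle. -/
lemma isHamCycleEdgeSet_of_numbering {V : Type*} [Fintype V] [DecidableEq V] {E : Set (Sym2 V)}
    {N : ℕ} (hN : 3 ≤ N) (g : V ≃ Fin N)
    (hE : ∀ x y, s(x, y) ∈ E ↔
      (g y : ℕ) = (g x + 1) % N ∨ (g x : ℕ) = (g y + 1) % N) :
    IsHamCycleEdgeSet E := by
  obtain ⟨m, rfl⟩ : ∃ m, N = m + 3 := ⟨N - 3, by omega⟩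
  have hadj (a b : Fin (m + 3)) :
      s(g.symm a, g.symm b) ∈ E ↔ (SimpleGraph.cycleGraph (m + 3)).Adj a b := by
    rw [hE, SimpleGraph.cycleGraph_adj, sub_eq_iff_eq_add, sub_eq_iff_eq_add]
    simp only [Equiv.apply_symm_apply, Fin.ext_iff, Fin.val_add, Fin.val_one, add_comm 1]
    tauto
  let f : SimpleGraph.cycleGraph (m + 3) →g SimpleGraph.fromEdgeSet E :=
    ⟨g.symm, fun {a b} h => ⟨(hadj a b).2 h, fun h' => h.ne (g.symm.injective h')⟩⟩
  have hham : (SimpleGraph.cycleGraph.cycle m).IsHamiltonianCycle :=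
    SimpleGraph.Walk.isHamiltonianCycle_iff_isCycle_and_length_eq.2
      ⟨SimpleGraph.cycleGraph.isCycle_cycle, by simp⟩
  refine ⟨_, (SimpleGraph.cycleGraph.cycle m).map f, hham.map g.symm.bijective, ?_⟩
  have hstep (a : Fin (m + 3)) : s(a, a + 1) ∈ (SimpleGraph.cycleGraph.cycle m).edges := by
    rw [Sym2.eq_swap, SimpleGraph.Walk.mk_mem_edges_iff_exists]
    refine ⟨m + 2 - a, by rw [SimpleGraph.cycleGraph.length_cycle]; omega, ?_⟩
    rw [SimpleGraph.cycleGraph.getVert_cycle (by omega),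
      SimpleGraph.cycleGraph.getVert_cycle (by omega)]
    have h1 : m + 3 - (m + 2 - (a : ℕ)) = a + 1 := by omega
    have h2 : m + 3 - (m + 2 - (a : ℕ) + 1) = a := by omega
    congr 1
    congr 1
    · simp [h1]
    · simp [h2, Nat.mod_eq_of_lt a.isLt]
  intro e
  rw [SimpleGraph.Walk.edges_map, List.mem_map]
  constructor
  · induction e using Sym2.ind with
    | _ x y =>
      intro h
      have h' : (SimpleGraph.cycleGraph (m + 3)).Adj (g x) (g y) := by
        rw [← hadj]; simpa using h
      refine ⟨s(g x, g y), ?_, Sym2.eq_iff.2 (.inl ⟨g.symm_apply_apply x, g.symm_apply_apply y⟩)⟩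
      rw [SimpleGraph.cycleGraph_adj, sub_eq_iff_eq_add', sub_eq_iff_eq_add'] at h'
      rcases h' with h' | h'
      · rw [h', Sym2.eq_swap]; exact hstep _
      · rw [h']; exact hstep _
  · rintro ⟨e, he, rfl⟩
    induction e using Sym2.ind with
    | _ a b => exact (hadj a b).2 (SimpleGraph.Walk.adj_of_mem_edges _ he)

/-- The position of a vertex in the sequence `cSeq n`. -/
def cPos (n : ℕ) (x : Vp n) : ℕ :=
  if x.2 = 0 then 2 * x.1 else if x.2 = 1 then 2 * x.1 + 1
  else if x.2 = 2 then 4 * n - 1 - 2 * x.1 else 4 * n - 2 - 2 * x.1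

lemma cPos_lt {n : ℕ} (x : Vp n) : cPos n x < 4 * n := by
  have := x.1.isLt
  unfold cPos
  split_ifs <;> omega

lemma cSeq_cPos {n : ℕ} (x : Vp n) : cSeq n ⟨cPos n x, cPos_lt x⟩ = x := by
  obtain ⟨a, c⟩ := x
  have := a.isLt
  fin_cases c <;> simp only [cSeq, cPos, Fin.reduceFinMk, Fin.reduceEq, if_true, if_false]
  · rw [dif_pos (by omega)]
    exact Prod.ext (Fin.ext (by simp)) (if_pos (by omega))
  · rw [dif_pos (by omega)]
    exact Prod.ext (Fin.ext (by simp; omega)) (if_neg (by omega))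
  · rw [dif_neg (by omega)]
    exact Prod.ext (Fin.ext (by simp; omega)) (if_pos (by omega))
  · rw [dif_neg (by omega)]
    exact Prod.ext (Fin.ext (by simp; omega)) (if_neg (by omega))

lemma cPos_cSeq {n : ℕ} (t : Fin (4 * n)) : cPos n (cSeq n t) = t := by
  have := t.isLt
  unfold cSeq
  split_ifs <;> simp [cPos] <;> omega

lemma cPos_injective (n : ℕ) : Function.Injective (cPos n) := fun x y h => by
  rw [← cSeq_cPos x, ← cSeq_cPos y]
  simp only [h]

lemma mk_mem_cEdges {n : ℕ} (x y : Vp n) :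
    s(x, y) ∈ cEdges n ↔
      cPos n y = (cPos n x + 1) % (4 * n) ∨ cPos n x = (cPos n y + 1) % (4 * n) := by
  constructor
  · rintro ⟨t, ht⟩
    rcases Sym2.eq_iff.1 ht with ⟨rfl, rfl⟩ | ⟨rfl, rfl⟩ <;> simp [cPos_cSeq]
  · have key (x y : Vp n) (h : cPos n y = (cPos n x + 1) % (4 * n)) : s(x, y) ∈ cEdges n :=
      ⟨⟨cPos n x, cPos_lt x⟩, by simp only [← h, cSeq_cPos]⟩
    rintro (h | h)
    · exact key x y h
    · rw [Sym2.eq_swap]; exact key y x h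

lemma mk_eq_mk_iff_cPos {n : ℕ} (x y u v : Vp n) :
    s(x, y) = s(u, v) ↔ (cPos n x = cPos n u ∧ cPos n y = cPos n v) ∨
      (cPos n x = cPos n v ∧ cPos n y = cPos n u) := by
  rw [Sym2.eq_iff, (cPos_injective n).eq_iff, (cPos_injective n).eq_iff,
    (cPos_injective n).eq_iff, (cPos_injective n).eq_iff]

lemma add_one_mod_spec {p N : ℕ} (h : p < N) :
    (p + 1 = N ∧ (p + 1) % N = 0) ∨ (p + 1 < N ∧ (p + 1) % N = p + 1) := by
  rcases Nat.lt_or_ge (p + 1) N with h' | h'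
  · exact .inr ⟨h', Nat.mod_eq_of_lt h'⟩
  · exact .inl ⟨by omega, by rw [show p + 1 = N by omega, Nat.mod_self]⟩

lemma add_one_mod_eq_ite {p N : ℕ} (h : p < N) :
    (p + 1) % N = if p + 1 = N then 0 else p + 1 := by
  split_ifs with h'
  · simp [h']
  · exact Nat.mod_eq_of_lt (by omega)

/-- The position in the tour obtained by the `4`-move, as a function of the position in `C`. -/
def movePos (n i j k p : ℕ) : ℕ :=
  if p ≤ 2 * i then p
  else if p ≤ 2 * j then 4 * n - 1 - 2 * k + 2 * i - p
  else if p ≤ 2 * k then p + 2 * i - 2 * j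
  else if p ≤ 4 * n - 2 - 2 * k then 4 * n - 1 + 2 * i - 2 * j - p
  else p

lemma movePos_lt {n i j k p : ℕ} (hij : i < j) (hjk : j < k) (hk : k < n) (hp : p < 4 * n) :
    movePos n i j k p < 4 * n := by
  unfold movePos
  split_ifs <;> omega

lemma movePos_inj {n i j k p q : ℕ} (hij : i < j) (hjk : j < k) (hk : k < n)
    (h : movePos n i j k p = movePos n i j k q) : p = q := by
  unfold movePos at h
  split_ifs at h <;> omega

lemma movePos_spec (n i j k p : ℕ) :
    (p ≤ 2 * i ∧ movePos n i j k p = p) ∨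
    (2 * i < p ∧ p ≤ 2 * j ∧ movePos n i j k p = 4 * n - 1 - 2 * k + 2 * i - p) ∨
    (2 * j < p ∧ p ≤ 2 * k ∧ movePos n i j k p = p + 2 * i - 2 * j) ∨
    (2 * k < p ∧ p ≤ 4 * n - 2 - 2 * k ∧ movePos n i j k p = 4 * n - 1 + 2 * i - 2 * j - p) ∨
    (4 * n - 2 - 2 * k < p ∧ movePos n i j k p = p) := by
  unfold movePos
  split_ifs <;> omega

lemma movePos_succ_of_forward {n i j k p q : ℕ} (hij : i < j) (hjk : j < k) (hk : k < n)
    (hp : p < 4 * n) (h : q = (p + 1) % (4 * n))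
    (hr : p < 2 * i ∨ (2 * j < p ∧ p < 2 * k) ∨ 4 * n - 2 - 2 * k < p) :
    movePos n i j k q = (movePos n i j k p + 1) % (4 * n) := by
  have h3 := add_one_mod_spec hp
  have h4 := add_one_mod_spec (movePos_lt hij hjk hk hp)
  rw [← h] at h3
  clear h
  have h1 := movePos_spec n i j k p
  have h2 := movePos_spec n i j k q
  generalize movePos n i j k p = p' at *
  generalize movePos n i j k q = q' at *
  generalize (p' + 1) % (4 * n) = r' at *
  rcases hr with hr | hr | hr <;> rcases h3 with h3 | h3 <;> omega

lemma movePos_succ_of_backward {n i j k p q : ℕ} (hij : i < j) (hjk : j < k) (hk : k < n)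
    (h : p = q + 1)
    (hr : (2 * i + 1 < p ∧ p ≤ 2 * j) ∨ (2 * k + 1 < p ∧ p ≤ 4 * n - 2 - 2 * k)) :
    movePos n i j k q = (movePos n i j k p + 1) % (4 * n) := by
  have hp : p < 4 * n := by omega
  have h4 := add_one_mod_spec (movePos_lt hij hjk hk hp)
  have h1 := movePos_spec n i j k p
  have h2 := movePos_spec n i j k q
  generalize movePos n i j k p = p' at *
  generalize movePos n i j k q = q' at *
  generalize (p' + 1) % (4 * n) = r' at *
  rcases hr with hr | hr <;> omega

lemma movePos_succ_of_succ {n i j k p q : ℕ} (hij : i < j) (hjk : j < k) (hk : k < n)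
    (hp : p < 4 * n) (hi : p ≠ 2 * i) (hj : p ≠ 2 * j) (hk' : p ≠ 2 * k)
    (hk'' : p ≠ 4 * n - 2 - 2 * k) (h : q = (p + 1) % (4 * n)) :
    movePos n i j k q = (movePos n i j k p + 1) % (4 * n) ∨
      movePos n i j k p = (movePos n i j k q + 1) % (4 * n) := by
  by_cases hr : p < 2 * i ∨ (2 * j < p ∧ p < 2 * k) ∨ 4 * n - 2 - 2 * k < p
  · exact .inl (movePos_succ_of_forward hij hjk hk hp h hr)
  · have hq : q = p + 1 := by rw [h, Nat.mod_eq_of_lt (by omega)]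
    exact .inr (movePos_succ_of_backward hij hjk hk hq (by omega))

lemma movePos_succ_of_inserted {n i j k p q : ℕ} (hij : i < j) (hjk : j < k) (hk : k < n)
    (h : (p = 2 * i ∧ q = 2 * j + 1) ∨ (p = 2 * k ∧ q = 4 * n - 2 - 2 * k) ∨
      (p = 2 * k + 1 ∧ q = 2 * j) ∨ (p = 2 * i + 1 ∧ q = 4 * n - 1 - 2 * k)) :
    movePos n i j k q = (movePos n i j k p + 1) % (4 * n) := by
  have hp : p < 4 * n := by omega
  have h5 := add_one_mod_spec (movePos_lt hij hjk hk hp)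
  have h1 := movePos_spec n i j k p
  have h2 := movePos_spec n i j k q
  generalize movePos n i j k p = p' at *
  generalize movePos n i j k q = q' at *
  generalize (p' + 1) % (4 * n) = r' at *
  rcases h with ⟨rfl, rfl⟩ | ⟨rfl, rfl⟩ | ⟨rfl, rfl⟩ | ⟨rfl, rfl⟩ <;> omega

lemma succ_or_of_movePos_succ {n i j k p q : ℕ} (hij : i < j) (hjk : j < k) (hk : k < n)
    (hp : p < 4 * n)
    (h : movePos n i j k q = (movePos n i j k p + 1) % (4 * n)) :
    (q = (p + 1) % (4 * n) ∧ p ≠ 2 * i ∧ p ≠ 2 * j ∧ p ≠ 2 * k ∧ p ≠ 4 * n - 2 - 2 * k) ∨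
    (p = (q + 1) % (4 * n) ∧ q ≠ 2 * i ∧ q ≠ 2 * j ∧ q ≠ 2 * k ∧ q ≠ 4 * n - 2 - 2 * k) ∨
    (p = 2 * i ∧ q = 2 * j + 1) ∨ (p = 2 * k ∧ q = 4 * n - 2 - 2 * k) ∨
    (p = 2 * k + 1 ∧ q = 2 * j) ∨ (p = 2 * i + 1 ∧ q = 4 * n - 1 - 2 * k) := by
  have huniq {r : ℕ} (hr : movePos n i j k r = (movePos n i j k p + 1) % (4 * n)) : q = r :=
    movePos_inj hij hjk hk (h.trans hr.symm)
  have hins {r : ℕ} (hr : (p = 2 * i ∧ r = 2 * j + 1) ∨ (p = 2 * k ∧ r = 4 * n - 2 - 2 * k) ∨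
      (p = 2 * k + 1 ∧ r = 2 * j) ∨ (p = 2 * i + 1 ∧ r = 4 * n - 1 - 2 * k)) : q = r :=
    huniq (movePos_succ_of_inserted hij hjk hk hr)
  by_cases h1 : p = 2 * i
  · exact .inr (.inr (.inl ⟨h1, hins (.inl ⟨h1, rfl⟩)⟩))
  by_cases h2 : p = 2 * k
  · exact .inr (.inr (.inr (.inl ⟨h2, hins (.inr (.inl ⟨h2, rfl⟩))⟩)))
  by_cases h3 : p = 2 * k + 1
  · exact .inr (.inr (.inr (.inr (.inl ⟨h3, hins (.inr (.inr (.inl ⟨h3, rfl⟩)))⟩))))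
  by_cases h4 : p = 2 * i + 1
  · exact .inr (.inr (.inr (.inr (.inr ⟨h4, hins (.inr (.inr (.inr ⟨h4, rfl⟩)))⟩))))
  by_cases hr : p < 2 * i ∨ (2 * j < p ∧ p < 2 * k) ∨ 4 * n - 2 - 2 * k < p
  · exact .inl ⟨huniq (movePos_succ_of_forward hij hjk hk hp rfl hr), by omega⟩
  · have hq : q = p - 1 := huniq (movePos_succ_of_backward hij hjk hk (by omega) (by omega))
    refine .inr (.inl ⟨?_, by omega⟩)
    rw [Nat.mod_eq_of_lt (by omega)]
    omega

lemma mem_move_of_movePos_succ {n : ℕ} {i j k : Fin n} (hij : (i : ℕ) < j) (hjk : (j : ℕ) < k)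
    {x y : Vp n}
    (h : movePos n i j k (cPos n y) = (movePos n i j k (cPos n x) + 1) % (4 * n)) :
    s(x, y) ∈ (cEdges n \ {s((i, 0), (i, 1)), s((j, 0), (j, 1)), s((k, 0), (k, 1)),
          s((k, 2), (k, 3))}) ∪
        {s((i, 0), (j, 1)), s((j, 0), (k, 1)), s((k, 0), (k, 3)), s((k, 2), (i, 1))} := by
  have hk := k.isLt
  have hx := cPos_lt x
  have hy := cPos_lt y
  simp only [Set.mem_union, Set.mem_sdiff, Set.mem_insert_iff, Set.mem_singleton_iff,
    mk_mem_cEdges, mk_eq_mk_iff_cPos]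
  generalize cPos n x = p at *
  generalize cPos n y = q at *
  simp only [cPos, Fin.reduceEq, if_true, if_false]
  have hp := add_one_mod_spec hx
  have hq := add_one_mod_spec hy
  rcases succ_or_of_movePos_succ hij hjk hk hx h with ⟨h, h'⟩ | ⟨h, h'⟩ | h
  · refine .inl ⟨.inl h, ?_⟩
    rw [← h] at hp
    clear hq
    rintro ((h | h) | (h | h) | (h | h) | (h | h)) <;> omega
  · refine .inl ⟨.inr h, ?_⟩
    rw [← h] at hq
    clear hp
    rintro ((h | h) | (h | h) | (h | h) | (h | h)) <;> omega
  · rcases h with h | h | h | h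
    · exact .inr (.inl (.inl h))
    · exact .inr (.inr (.inr (.inl (.inl h))))
    · exact .inr (.inr (.inl (.inr h)))
    · exact .inr (.inr (.inr (.inr (.inr h))))

lemma movePos_succ_or_of_mem_move {n : ℕ} {i j k : Fin n} (hij : (i : ℕ) < j)
    (hjk : (j : ℕ) < k) {x y : Vp n}
    (h : s(x, y) ∈ (cEdges n \ {s((i, 0), (i, 1)), s((j, 0), (j, 1)), s((k, 0), (k, 1)),
          s((k, 2), (k, 3))}) ∪
        {s((i, 0), (j, 1)), s((j, 0), (k, 1)), s((k, 0), (k, 3)), s((k, 2), (i, 1))}) :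
    movePos n i j k (cPos n y) = (movePos n i j k (cPos n x) + 1) % (4 * n) ∨
      movePos n i j k (cPos n x) = (movePos n i j k (cPos n y) + 1) % (4 * n) := by
  have hk := k.isLt
  have hx := cPos_lt x
  have hy := cPos_lt y
  revert h
  simp only [Set.mem_union, Set.mem_sdiff, Set.mem_insert_iff, Set.mem_singleton_iff,
    mk_mem_cEdges, mk_eq_mk_iff_cPos]
  generalize cPos n x = p at *
  generalize cPos n y = q at *
  simp only [cPos, Fin.reduceEq, if_true, if_false]
  have hsucc {p q r : ℕ} (h : q = (p + 1) % (4 * n)) (hp : p = r) (hr : r + 1 < 4 * n) :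
      q = r + 1 := by
    rw [h, hp, Nat.mod_eq_of_lt hr]
  have hlast : 4 * n - 2 - 2 * (k : ℕ) + 1 = 4 * n - 1 - 2 * k := by omega
  rintro (⟨h | h, hn⟩ | (h | h) | (h | h) | (h | h) | (h | h))
  · exact movePos_succ_of_succ hij hjk hk hx
      (fun e => hn (.inl (.inl ⟨e, hsucc h e (by clear hn; omega)⟩)))
      (fun e => hn (.inr (.inl (.inl ⟨e, hsucc h e (by clear hn; omega)⟩))))
      (fun e => hn (.inr (.inr (.inl (.inl ⟨e, hsucc h e (by clear hn; omega)⟩)))))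
      (fun e => hn (.inr (.inr (.inr (.inr
        ⟨e, (hsucc h e (by clear hn; omega)).trans hlast⟩))))) h
  · exact (movePos_succ_of_succ hij hjk hk hy
      (fun e => hn (.inl (.inr ⟨hsucc h e (by clear hn; omega), e⟩)))
      (fun e => hn (.inr (.inl (.inr ⟨hsucc h e (by clear hn; omega), e⟩))))
      (fun e => hn (.inr (.inr (.inl (.inr ⟨hsucc h e (by clear hn; omega), e⟩)))))
      (fun e => hn (.inr (.inr (.inr (.inl
        ⟨(hsucc h e (by clear hn; omega)).trans hlast, e⟩))))) h).symm
  · exact .inl (movePos_succ_of_inserted hij hjk hk (.inl h))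
  · exact .inr (movePos_succ_of_inserted hij hjk hk (.inl ⟨h.2, h.1⟩))
  · exact .inr (movePos_succ_of_inserted hij hjk hk (.inr (.inr (.inl ⟨h.2, h.1⟩))))
  · exact .inl (movePos_succ_of_inserted hij hjk hk (.inr (.inr (.inl h))))
  · exact .inl (movePos_succ_of_inserted hij hjk hk (.inr (.inl h)))
  · exact .inr (movePos_succ_of_inserted hij hjk hk (.inr (.inl ⟨h.2, h.1⟩)))
  · exact .inr (movePos_succ_of_inserted hij hjk hk (.inr (.inr (.inr ⟨h.2, h.1⟩))))
  · exact .inl (movePos_succ_of_inserted hij hjk hk (.inr (.inr (.inr h))))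

lemma isHamCycleEdgeSet_move {n : ℕ} {i j k : Fin n} (hij : i < j) (hjk : j < k) :
    IsHamCycleEdgeSet
      ((cEdges n \ {s((i, 0), (i, 1)), s((j, 0), (j, 1)), s((k, 0), (k, 1)),
          s((k, 2), (k, 3))}) ∪
        {s((i, 0), (j, 1)), s((j, 0), (k, 1)), s((k, 0), (k, 3)), s((k, 2), (i, 1))}) := by
  have hk := k.isLt
  rw [Fin.lt_def] at hij hjk
  let f : Vp n → Fin (4 * n) := fun x =>
    ⟨movePos n i j k (cPos n x), movePos_lt hij hjk hk (cPos_lt x)⟩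
  have hf : Function.Bijective f := by
    refine (Fintype.bijective_iff_injective_and_card f).2 ⟨fun x y h => ?_, ?_⟩
    · exact cPos_injective n (movePos_inj hij hjk hk (Fin.ext_iff.1 h))
    · simp [mul_comm]
  refine isHamCycleEdgeSet_of_numbering (by omega) (Equiv.ofBijective f hf) fun x y => ?_
  refine ⟨movePos_succ_or_of_mem_move hij hjk, fun h => h.elim (mem_move_of_movePos_succ hij hjk)
    fun h => ?_⟩
  rw [Sym2.eq_swap (a := x) (b := y)]
  exact mem_move_of_movePos_succ hij hjk h

/-- If `i < j < k` and `w(v_i,v_j) + w(v_j,v_k) + w(v_k,v_i) < 0`,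
then removing `(a_i,b_i), (a_j,b_j), (a_k,b_k), (a_k',b_k')` from `C` and inserting
`(a_i,b_j), (a_j,b_k), (a_k,b_k'), (a_k',b_i)` yields a Hamiltonian cycle of `G'`
of total `w'`-weight strictly smaller than that of `C`; the removed edges have
total weight `0` and the inserted edges have total weight
`w(v_i,v_j) + w(v_j,v_k) + w(v_k,v_i) < 0`. -/
theorem stmt_12 (n : ℕ) (hn : 0 < n) (w : Sym2 (Fin n) → ℤ) (W : ℤ)
    (hW : IsGreatest { x : ℤ | ∃ u v : Fin n, u ≠ v ∧ x = |w s(u, v)| } W)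
    (w' : Sym2 (Vp n) → ℤ) (hw' : IsReductionWeight n hn w W w')
    (i j k : Fin n) (hij : i < j) (hjk : j < k)
    (hneg : w s(i, j) + w s(j, k) + w s(k, i) < 0) :
    IsHamCycleEdgeSet
        ((cEdges n \ {s((i, 0), (i, 1)), s((j, 0), (j, 1)), s((k, 0), (k, 1)),
            s((k, 2), (k, 3))}) ∪
          {s((i, 0), (j, 1)), s((j, 0), (k, 1)), s((k, 0), (k, 3)), s((k, 2), (i, 1))}) ∧
      (∑ᶠ e ∈ ({s((i, 0), (i, 1)), s((j, 0), (j, 1)), s((k, 0), (k, 1)),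
          s((k, 2), (k, 3))} : Set (Sym2 (Vp n))), w' e) = 0 ∧
      (∑ᶠ e ∈ ({s((i, 0), (j, 1)), s((j, 0), (k, 1)), s((k, 0), (k, 3)),
          s((k, 2), (i, 1))} : Set (Sym2 (Vp n))), w' e) =
        w s(i, j) + w s(j, k) + w s(k, i) ∧
      (∑ᶠ e ∈ ((cEdges n \ {s((i, 0), (i, 1)), s((j, 0), (j, 1)), s((k, 0), (k, 1)),
            s((k, 2), (k, 3))}) ∪
          {s((i, 0), (j, 1)), s((j, 0), (k, 1)), s((k, 0), (k, 3)), s((k, 2), (i, 1))}),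
          w' e) <
        ∑ᶠ e ∈ cEdges n, w' e := by
  obtain ⟨h03, h01, h21, h00, h23, -⟩ := hw'
  have hik := hij.trans hjk
  have hEm : (∑ᶠ e ∈ ({s((i, 0), (i, 1)), s((j, 0), (j, 1)), s((k, 0), (k, 1)),
      s((k, 2), (k, 3))} : Set (Sym2 (Vp n))), w' e) = 0 := by
    rw [finsum_mem_insert _ (by simp [hij.ne, hik.ne]) (Set.toFinite _),
      finsum_mem_insert _ (by simp [hjk.ne]) (Set.toFinite _),
      finsum_mem_insert _ (by simp) (Set.toFinite _), finsum_mem_singleton,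
      h00, h00, h00, h23]
    ring
  have hEp : (∑ᶠ e ∈ ({s((i, 0), (j, 1)), s((j, 0), (k, 1)), s((k, 0), (k, 3)),
      s((k, 2), (i, 1))} : Set (Sym2 (Vp n))), w' e) = w s(i, j) + w s(j, k) + w s(k, i) := by
    rw [finsum_mem_insert _ (by simp [hij.ne, hik.ne]) (Set.toFinite _),
      finsum_mem_insert _ (by simp) (Set.toFinite _),
      finsum_mem_insert _ (by simp) (Set.toFinite _), finsum_mem_singleton,
      h01 _ _ hij, h01 _ _ hjk, h03, h21 _ _ hik]
    ring
  refine ⟨isHamCycleEdgeSet_move hij hjk, hEm, hEp, ?_⟩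
  have hk := k.isLt
  rw [Fin.lt_def] at hij hjk hik
  have hsub : ({s((i, 0), (i, 1)), s((j, 0), (j, 1)), s((k, 0), (k, 1)),
      s((k, 2), (k, 3))} : Set (Sym2 (Vp n))) ⊆ cEdges n := by
    simp only [Set.insert_subset_iff, Set.singleton_subset_iff, mk_mem_cEdges,
      add_one_mod_eq_ite (cPos_lt _)]
    simp only [cPos, Fin.reduceEq, if_true, if_false]
    split_ifs <;> omega
  have hdisj : Disjoint (cEdges n) ({s((i, 0), (j, 1)), s((j, 0), (k, 1)), s((k, 0), (k, 3)),
      s((k, 2), (i, 1))} : Set (Sym2 (Vp n))) := by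
    simp only [Set.disjoint_insert_right, Set.disjoint_singleton_right, mk_mem_cEdges,
      add_one_mod_eq_ite (cPos_lt _)]
    simp only [cPos, Fin.reduceEq, if_true, if_false]
    split_ifs <;> omega
  rw [finsum_mem_union (hdisj.mono_left Set.sdiff_subset) (Set.toFinite _) (Set.toFinite _), hEp]
  have hadd := finsum_mem_add_sdiff (f := w') hsub (Set.toFinite _)
  rw [hEm] at hadd
  linarith
end
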